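/- arXiv:1309.5336 — 2 statements merged into one kernel-verified Lean document; each statement's English description precedes it below -/
import Mathlib

section
/- Let G be a 3-connected bipartite graph with bipartition (A,B) containing a hex H with feet v_1,...,v_6 all of which (at least five of which, say v_1,...,v_5) lie in A, and let u be an internal vertex of the segment P_{14} lying in B. Then there exist a hex H' of G and a vertex in it such that H' has strictly more odd segments than H; in particular H is not optimal. -/
open SimpleGraph

universe u

variable {V : Type u}

/-- A planar embedding of a simple graph: vertices go to distinct points of the plane and
edges to arcs (injective topological paths) that meet only at common endpoints. -/
structure PlanarEmbedding (G : SimpleGraph V) where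
  vmap : V → ℝ × ℝ
  vmap_inj : Function.Injective vmap
  arc : ∀ ⦃x y : V⦄, G.Adj x y → _root_.Path (vmap x) (vmap y)
  arc_inj : ∀ ⦃x y : V⦄ (h : G.Adj x y), Function.Injective ⇑(arc h)
  arc_symm : ∀ ⦃x y : V⦄ (h : G.Adj x y), Set.range ⇑(arc h) = Set.range ⇑(arc h.symm)
  arc_vertex : ∀ ⦃x y : V⦄ (h : G.Adj x y) (w : V), vmap w ∈ Set.range ⇑(arc h) → w = x ∨ w = y
  arc_disjoint : ∀ ⦃x y x' y' : V⦄ (h : G.Adj x y) (h' : G.Adj x' y'),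
      s(x, y) ≠ s(x', y') →
      Set.range ⇑(arc h) ∩ Set.range ⇑(arc h') ⊆
        ({vmap x, vmap y} ∩ {vmap x', vmap y'} : Set (ℝ × ℝ))

/-- A graph is planar if it admits a planar embedding. -/
def SimpleGraph.IsPlanar (G : SimpleGraph V) : Prop := Nonempty (PlanarEmbedding G)

/-- `(A, B)` is a bipartition of `G`. -/
def SimpleGraph.IsBipartition (G : SimpleGraph V) (A B : Set V) : Prop :=
  Disjoint A B ∧ A ∪ B = Set.univ ∧
    ∀ ⦃x y : V⦄, G.Adj x y → (x ∈ A ∧ y ∈ B) ∨ (x ∈ B ∧ y ∈ A)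

/-- A finite graph is 3-connected: more than 3 vertices and removing at most 2 vertices
leaves a connected graph. -/
def SimpleGraph.ThreeConnected [Fintype V] (G : SimpleGraph V) : Prop :=
  4 ≤ Fintype.card V ∧ ∀ S : Set V, S.ncard ≤ 2 → (G.induce Sᶜ).Connected

/-- Internally 4-connected: 3-connected, at least five vertices, and no partition
`(A, B, C)` of the vertices with `|A|, |B| ≥ 2`, `|C| = 3` and no edge between `A` and `B`. -/
def SimpleGraph.InternallyFourConnected [Fintype V] (G : SimpleGraph V) : Prop :=
  G.ThreeConnected ∧ 5 ≤ Fintype.card V ∧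
    ¬ ∃ A B C : Set V, A ∪ B ∪ C = Set.univ ∧ Disjoint A B ∧ Disjoint A C ∧ Disjoint B C ∧
      2 ≤ A.ncard ∧ 2 ≤ B.ncard ∧ C.ncard = 3 ∧ ∀ x ∈ A, ∀ y ∈ B, ¬ G.Adj x y

/-- A hex in `G`: a subdivision of `K_{3,3}` with feet `fA 0, fA 1, fA 2` on one side and
`fB 0, fB 1, fB 2` on the other, and nine internally disjoint segments `seg i j`. -/
structure SimpleGraph.Hex (G : SimpleGraph V) where
  fA : Fin 3 → V
  fB : Fin 3 → V
  injA : Function.Injective fA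
  injB : Function.Injective fB
  disjAB : ∀ i j, fA i ≠ fB j
  seg : (i j : Fin 3) → G.Walk (fA i) (fB j)
  seg_path : ∀ i j, (seg i j).IsPath
  seg_meet : ∀ i j i' j', (i, j) ≠ (i', j') → ∀ x : V, x ∈ (seg i j).support →
      x ∈ (seg i' j').support → (x = fA i ∧ i = i') ∨ (x = fB j ∧ j = j')

/-- The number of odd segments of a hex. -/
noncomputable def SimpleGraph.Hex.oddCount {G : SimpleGraph V} (H : G.Hex) : ℕ :=
  (Finset.univ.filter fun p : Fin 3 × Fin 3 => Odd (H.seg p.1 p.2).length).card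

/-- A hex is odd if all nine segments have odd length. -/
def SimpleGraph.Hex.IsOdd {G : SimpleGraph V} (H : G.Hex) : Prop :=
  ∀ i j, Odd (H.seg i j).length

/-- A hex is optimal if no hex of `G` has strictly more odd segments. -/
def SimpleGraph.Hex.Optimal {G : SimpleGraph V} (H : G.Hex) : Prop :=
  ∀ H' : G.Hex, H'.oddCount ≤ H.oddCount

/-- The vertex set of a walk, as a set. -/
def SimpleGraph.Walk.supp {G : SimpleGraph V} {x y : V} (w : G.Walk x y) : Set V :=
  {z | z ∈ w.support}

/-- The vertex set of a hex. -/
def SimpleGraph.Hex.suppSet {G : SimpleGraph V} (H : G.Hex) : Set V :=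
  ⋃ (i : Fin 3) (j : Fin 3), (H.seg i j).supp

/-- The edge set of a hex. -/
def SimpleGraph.Hex.edgeSetH {G : SimpleGraph V} (H : G.Hex) : Set (Sym2 V) :=
  ⋃ (i : Fin 3) (j : Fin 3), {e | e ∈ (H.seg i j).edges}

/-- `a` and `b` are joined by a walk of `G` all of whose vertices lie in `S`. -/
def SimpleGraph.JoinedIn (G : SimpleGraph V) (S : Set V) (a b : V) : Prop :=
  ∃ w : G.Walk a b, ∀ z ∈ w.support, z ∈ S

namespace SimpleGraph.JoinedIn

variable {G : SimpleGraph V} {S T : Set V} {a b c : V}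

lemma refl (h : a ∈ S) : G.JoinedIn S a a := ⟨Walk.nil, by simpa using h⟩

lemma symm (h : G.JoinedIn S a b) : G.JoinedIn S b a := by
  obtain ⟨w, hw⟩ := h
  exact ⟨w.reverse, by simpa using hw⟩

lemma mono (h : G.JoinedIn S a b) (hST : S ⊆ T) : G.JoinedIn T a b := by
  obtain ⟨w, hw⟩ := h
  exact ⟨w, fun z hz => hST (hw z hz)⟩

lemma mono_graph {G' : SimpleGraph V} (h : G.JoinedIn S a b) (hG : G ≤ G') :
    G'.JoinedIn S a b := by
  obtain ⟨w, hw⟩ := h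
  exact ⟨w.mapLe hG, by simpa using hw⟩

lemma trans (h : G.JoinedIn S a b) (h' : G.JoinedIn S b c) : G.JoinedIn S a c := by
  obtain ⟨w, hw⟩ := h
  obtain ⟨w', hw'⟩ := h'
  refine ⟨w.append w', fun z hz => ?_⟩
  rw [Walk.mem_support_append_iff] at hz
  exact hz.elim (hw z) (hw' z)

lemma trans_union (h : G.JoinedIn S a b) (h' : G.JoinedIn T b c) : G.JoinedIn (S ∪ T) a c :=
  (h.mono Set.subset_union_left).trans (h'.mono Set.subset_union_right)

lemma of_adj (h : G.Adj a b) (ha : a ∈ S) (hb : b ∈ S) : G.JoinedIn S a b :=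
  ⟨h.toWalk, by simp [ha, hb]⟩

lemma left_mem (h : G.JoinedIn S a b) : a ∈ S := by
  obtain ⟨w, hw⟩ := h
  exact hw _ w.start_mem_support

lemma right_mem (h : G.JoinedIn S a b) : b ∈ S := h.symm.left_mem

lemma exists_isPath (h : G.JoinedIn S a b) :
    ∃ w : G.Walk a b, w.IsPath ∧ ∀ z ∈ w.support, z ∈ S := by
  classical
  obtain ⟨w, hw⟩ := h
  exact ⟨w.bypass, w.bypass_isPath, fun z hz => hw z (w.support_bypass_subset_support hz)⟩

/-- A joining set can be shrunk so that every other vertex is reached before the endpoint. -/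
lemma trim (h : G.JoinedIn S a b) : ∃ T ⊆ S, G.JoinedIn T a b ∧
    ∀ v ∈ T, v = b ∨ G.JoinedIn (T \ {b}) a v := by
  classical
  obtain ⟨w, hp, hw⟩ := h.exists_isPath
  refine ⟨{z | z ∈ w.support}, hw, ⟨w, fun _ h => h⟩, fun v hv => ?_⟩
  by_cases hvb : v = b
  · exact Or.inl hvb
  · refine Or.inr ⟨w.takeUntil v hv, fun z hz => ⟨w.support_takeUntil_subset_support hv hz, ?_⟩⟩
    rintro rfl
    exact Walk.endpoint_notMem_support_takeUntil hp hv (Ne.symm hvb) hz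

/-- The first step of a walk that does not return to its starting vertex. -/
lemma exists_adj (h : G.JoinedIn S a b) (hab : a ≠ b) :
    ∃ p, G.Adj a p ∧ G.JoinedIn (S \ {a}) p b := by
  obtain ⟨w, hp, hw⟩ := h.exists_isPath
  cases w with
  | nil => exact absurd rfl hab
  | cons hadj q =>
    rw [Walk.cons_isPath_iff] at hp
    refine ⟨_, hadj, q, fun z hz => ⟨hw z (by simp [hz]), ?_⟩⟩
    rintro rfl
    exact hp.2 hz

lemma deleteEdge (h : G.JoinedIn S a b) (x y : V) :
    (G.deleteEdges {s(x, y)}).JoinedIn S a b ∨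
    ((G.deleteEdges {s(x, y)}).JoinedIn S a x ∧ (G.deleteEdges {s(x, y)}).JoinedIn S y b) ∨
    ((G.deleteEdges {s(x, y)}).JoinedIn S a y ∧ (G.deleteEdges {s(x, y)}).JoinedIn S x b) := by
  obtain ⟨w, hw⟩ := h
  induction w with
  | nil => exact Or.inl (refl (hw _ (by simp)))
  | @cons a c b hadj q ih =>
    have ha : a ∈ S := hw _ (by simp)
    have hc : c ∈ S := hw _ (by simp)
    specialize ih fun z hz => hw z (by simp [hz])
    by_cases he : s(a, c) = s(x, y)
    · rw [Sym2.eq_iff] at he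
      rcases he with ⟨rfl, rfl⟩ | ⟨rfl, rfl⟩
      · rcases ih with h | ⟨_, h⟩ | ⟨_, h⟩
        · exact Or.inr (Or.inl ⟨refl ha, h⟩)
        · exact Or.inr (Or.inl ⟨refl ha, h⟩)
        · exact Or.inl h
      · rcases ih with h | ⟨_, h⟩ | ⟨_, h⟩
        · exact Or.inr (Or.inr ⟨refl ha, h⟩)
        · exact Or.inl h
        · exact Or.inr (Or.inr ⟨refl ha, h⟩)
    · have hac : (G.deleteEdges {s(x, y)}).JoinedIn S a c :=
        of_adj (by simpa [deleteEdges_adj] using ⟨hadj, by simpa using he⟩) ha hc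
      rcases ih with h | ⟨h, h'⟩ | ⟨h, h'⟩
      · exact Or.inl (hac.trans h)
      · exact Or.inr (Or.inl ⟨hac.trans h, h'⟩)
      · exact Or.inr (Or.inr ⟨hac.trans h, h'⟩)

end SimpleGraph.JoinedIn

namespace SimpleGraph

/-- No walk of `G` from `A` to `B` avoids `S`. -/
def Separates (G : SimpleGraph V) (A B : Set V) (S : Finset V) : Prop :=
  ∀ a ∈ A, ∀ b ∈ B, ¬ G.JoinedIn (↑S)ᶜ a b

/-- There are `k` pairwise disjoint walks of `G` from `A` to `B`. -/
def Linked (G : SimpleGraph V) (A B : Set V) (k : ℕ) : Prop :=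
  ∃ T : Finset V, T.card = k ∧ ∃ C : V → Set V,
    (∀ t ∈ T, ∃ a ∈ A, ∃ b ∈ B, G.JoinedIn (C t) a b) ∧
    ∀ t ∈ T, ∀ s ∈ T, ∀ v ∈ C t, v ∈ C s → t = s

/-- A linkage onto a set of its own size can be labelled by the endpoints. -/
lemma Linked.exists_label {G : SimpleGraph V} {A : Set V} {B : Finset V} {k : ℕ}
    (h : G.Linked A B k) (hB : B.card = k) :
    ∃ C : V → Set V, (∀ t ∈ B, ∃ a ∈ A, G.JoinedIn (C t) a t ∧
        ∀ v ∈ C t, v = t ∨ G.JoinedIn (C t \ {t}) a v) ∧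
      ∀ t ∈ B, ∀ t' ∈ B, ∀ v ∈ C t, v ∈ C t' → t = t' := by
  classical
  obtain ⟨T, hT, C, hC, hdisj⟩ := h
  have hex : ∀ t, ∃ b, t ∈ T → b ∈ B ∧ ∃ a ∈ A, G.JoinedIn (C t) a b := by
    intro t
    by_cases ht : t ∈ T
    · obtain ⟨a, ha, b, hb, hab⟩ := hC t ht
      exact ⟨b, fun _ => ⟨hb, a, ha, hab⟩⟩
    · exact ⟨t, fun h => absurd h ht⟩
  choose g hg using hex
  have hinj : Set.InjOn g T := by
    intro t ht t' ht' heq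
    obtain ⟨_, a, _, hab⟩ := hg t ht
    obtain ⟨_, a', _, hab'⟩ := hg t' ht'
    exact hdisj t ht t' ht' (g t) hab.right_mem (heq ▸ hab'.right_mem)
  have himg : T.image g = B := by
    apply Finset.eq_of_subset_of_card_le
    · intro b hb
      obtain ⟨t, ht, rfl⟩ := Finset.mem_image.1 hb
      exact (hg t ht).1
    · rw [Finset.card_image_of_injOn hinj, hT, hB]
  have hex : ∀ b, ∃ D : Set V, b ∈ B → ∃ t ∈ T, g t = b ∧ D ⊆ C t ∧ ∃ a ∈ A, G.JoinedIn D a b ∧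
      ∀ v ∈ D, v = b ∨ G.JoinedIn (D \ {b}) a v := by
    intro b
    by_cases hb : b ∈ B
    · rw [← himg] at hb
      obtain ⟨t, ht, rfl⟩ := Finset.mem_image.1 hb
      obtain ⟨_, a, ha, hab⟩ := hg t ht
      obtain ⟨D, hD, hD'⟩ := hab.trim
      exact ⟨D, fun _ => ⟨t, ht, rfl, hD, a, ha, hD'⟩⟩
    · exact ⟨∅, fun h => absurd h hb⟩
  choose D hD using hex
  refine ⟨D, fun b hb => ?_, fun b hb b' hb' v hv hv' => ?_⟩
  · obtain ⟨t, ht, _, _, h⟩ := hD b hb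
    exact h
  · obtain ⟨t, ht, rfl, hs, _⟩ := hD b hb
    obtain ⟨t', ht', rfl, hs', _⟩ := hD b' hb'
    rw [hdisj t ht t' ht' v (hs hv) (hs' hv')]

lemma Separates.symm {G : SimpleGraph V} {A B : Set V} {S : Finset V} (h : G.Separates A B S) :
    G.Separates B A S := fun b hb a ha hab => h a ha b hb hab.symm

/-- If `S` separates `A` from `B` once the edge `xy` is deleted, with `y` beyond `S`, then
separating `A` from `S ∪ {x}` without `xy` suffices to separate `A` from `B`. -/
lemma Separates.of_deleteEdge [DecidableEq V] {G : SimpleGraph V} {A B : Set V} {S Z : Finset V}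
    {x y : V} (hS : (G.deleteEdges {s(x, y)}).Separates A B S)
    (hy : ∀ a ∈ A, ¬ (G.deleteEdges {s(x, y)}).JoinedIn (↑S)ᶜ a y)
    (hZ : (G.deleteEdges {s(x, y)}).Separates A ↑(insert x S) Z) : G.Separates A B Z := by
  rintro a ha b hb ⟨w, hw⟩
  have key : ∀ c (q : G.Walk c b), (∀ z ∈ q.support, z ∈ (↑Z : Set V)ᶜ) →
      (G.deleteEdges {s(x, y)}).JoinedIn ((↑Z)ᶜ ∩ (↑S)ᶜ) a c → False := by
    intro c q
    clear hw w
    induction q with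
    | nil => exact fun _ h => hS a ha _ hb (h.mono Set.inter_subset_right)
    | @cons c d b hadj q ih =>
      intro hq h
      have hcx : c ≠ x := by
        rintro rfl
        exact hZ a ha c (by simp) (h.mono Set.inter_subset_left)
      have hcy : c ≠ y := by
        rintro rfl
        exact hy a ha (h.mono Set.inter_subset_right)
      have hadj' : (G.deleteEdges {s(x, y)}).Adj c d := by
        rw [deleteEdges_adj]
        refine ⟨hadj, ?_⟩
        simp [hcx, hcy]
      have hd : d ∈ (↑Z : Set V)ᶜ := hq d (by simp)
      have hdS : d ∉ S := fun hdS => hZ a ha d (by simp [hdS])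
        ((h.mono Set.inter_subset_left).trans (.of_adj hadj' (hq c (by simp)) hd))
      exact ih hb (fun z hz => hq z (by simp [hz])) (h.trans (.of_adj hadj' h.right_mem ⟨hd, hdS⟩))
  have haZ := hw a w.start_mem_support
  refine key a w hw (.refl ⟨haZ, fun haS => ?_⟩)
  exact hZ a ha a (by simpa using Or.inr haS) (.refl haZ)

/-- **Menger's theorem** for disjoint walks between two vertex sets. -/
theorem linked_of_forall_separates [Finite V] (G : SimpleGraph V) (A B : Set V) (k : ℕ)
    (h : ∀ S : Finset V, G.Separates A B S → k ≤ S.card) : G.Linked A B k := by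
  classical
  induction hn : G.edgeSet.ncard using Nat.strong_induction_on generalizing G A B with
  | _ n ih =>
  by_cases hE : ∃ x y, G.Adj x y
  swap
  · push Not at hE
    have hfin : (A ∩ B).Finite := Set.toFinite _
    have hk : k ≤ hfin.toFinset.card := by
      refine h _ fun a ha b hb hab => ?_
      obtain ⟨w, hw⟩ := hab
      cases w with
      | nil => exact hw a (by simp) (by simpa using ⟨ha, hb⟩)
      | cons hadj _ => exact hE _ _ hadj
    obtain ⟨T, hTs, hT⟩ := Finset.exists_subset_card_eq hk
    refine ⟨T, hT, fun t => {t}, fun t ht => ?_, ?_⟩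
    · have := hTs ht
      simp only [Set.Finite.mem_toFinset, Set.mem_inter_iff] at this
      exact ⟨t, this.1, t, this.2, .refl rfl⟩
    · rintro t _ t' _ v rfl h
      exact h
  obtain ⟨x₀, y₀, hxy₀⟩ := hE
  by_cases hsep : ∀ S : Finset V, (G.deleteEdges {s(x₀, y₀)}).Separates A B S → k ≤ S.card
  · have hlt : (G.deleteEdges {s(x₀, y₀)}).edgeSet.ncard < n := by
      rw [← hn, edgeSet_deleteEdges]
      exact Set.ncard_sdiff_singleton_lt_of_mem hxy₀
    obtain ⟨T, hT, C, hC, hdisj⟩ := ih _ hlt _ A B hsep rfl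
    refine ⟨T, hT, C, fun t ht => ?_, hdisj⟩
    obtain ⟨a, ha, b, hb, hab⟩ := hC t ht
    exact ⟨a, ha, b, hb, hab.mono_graph (deleteEdges_le _)⟩
  push Not at hsep
  obtain ⟨S, hS, hSk⟩ := hsep
  have hside : ∃ x y, s(x, y) = s(x₀, y₀) ∧
      (∃ a ∈ A, (G.deleteEdges {s(x₀, y₀)}).JoinedIn (↑S)ᶜ a x) ∧
      ∃ b ∈ B, (G.deleteEdges {s(x₀, y₀)}).JoinedIn (↑S)ᶜ y b := by
    have hnot : ¬ G.Separates A B S := fun hc => absurd (h S hc) (not_le.2 hSk)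
    unfold Separates at hnot
    push Not at hnot
    obtain ⟨a, ha, b, hb, hab⟩ := hnot
    rcases hab.deleteEdge x₀ y₀ with h1 | ⟨h1, h2⟩ | ⟨h1, h2⟩
    · exact absurd h1 (hS a ha b hb)
    · exact ⟨x₀, y₀, rfl, ⟨a, ha, h1⟩, b, hb, h2⟩
    · exact ⟨y₀, x₀, Sym2.eq_swap, ⟨a, ha, h1⟩, b, hb, h2⟩
  obtain ⟨x, y, he, ⟨a₀, ha₀, hax⟩, b₀, hb₀, hyb⟩ := hside
  have hxy : G.Adj x y := by
    rw [← mem_edgeSet, he]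
    exact hxy₀
  rw [← he] at hS hax hyb
  clear he hxy₀ x₀ y₀
  have hlt : (G.deleteEdges {s(x, y)}).edgeSet.ncard < n := by
    rw [← hn, edgeSet_deleteEdges]
    exact Set.ncard_sdiff_singleton_lt_of_mem hxy
  have hswap : G.deleteEdges {s(y, x)} = G.deleteEdges {s(x, y)} := by rw [Sym2.eq_swap]
  have hA : ∀ Z : Finset V, (G.deleteEdges {s(x, y)}).Separates A ↑(insert x S) Z → k ≤ Z.card :=
    fun Z hZ => h Z (hS.of_deleteEdge (fun a ha hay => hS a ha b₀ hb₀ (hay.trans hyb)) hZ)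
  have hB : ∀ Z : Finset V, (G.deleteEdges {s(x, y)}).Separates B ↑(insert y S) Z → k ≤ Z.card := by
    intro Z hZ
    refine h Z (Separates.of_deleteEdge (x := y) (y := x) (S := S) ?_ ?_ ?_).symm
    · rw [hswap]
      exact hS.symm
    · rw [hswap]
      exact fun b hb hbx => hS a₀ ha₀ b hb (hax.trans hbx.symm)
    · rwa [hswap]
  have hxcard : k ≤ (insert x S).card := hA _ fun a _ t ht hat => hat.right_mem ht
  have hycard : k ≤ (insert y S).card := hB _ fun a _ t ht hat => hat.right_mem ht
  have hxS : x ∉ S := fun hc => by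
    rw [Finset.insert_eq_of_mem hc] at hxcard
    omega
  have hyS : y ∉ S := fun hc => by
    rw [Finset.insert_eq_of_mem hc] at hycard
    omega
  rw [Finset.card_insert_of_notMem hxS] at hxcard
  have hxk : (insert x S).card = k := by
    rw [Finset.card_insert_of_notMem hxS]
    omega
  have hyk : (insert y S).card = k := by
    rw [Finset.card_insert_of_notMem hyS]
    omega
  obtain ⟨P, hP, hPd⟩ := (ih _ hlt _ A _ hA rfl).exists_label hxk
  obtain ⟨Q, hQ, hQd⟩ := (ih _ hlt _ B _ hB rfl).exists_label hyk
  have hPmem : ∀ t ∈ insert x S, t ∈ P t := fun t ht => by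
    obtain ⟨_, _, h, _⟩ := hP t ht
    exact h.right_mem
  have hQmem : ∀ t ∈ insert y S, t ∈ Q t := fun t ht => by
    obtain ⟨_, _, h, _⟩ := hQ t ht
    exact h.right_mem
  have hPreach : ∀ t ∈ insert x S, ∀ v ∈ P t, v ∉ S →
      ∃ a ∈ A, (G.deleteEdges {s(x, y)}).JoinedIn (↑S)ᶜ a v := by
    intro t ht v hv hvS
    obtain ⟨a, ha, h1, h2⟩ := hP t ht
    refine ⟨a, ha, ?_⟩
    have hts : ∀ s ∈ S, s ∈ P t → s = t := fun s hs hst =>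
      hPd s (by simp [hs]) t ht s (hPmem s (by simp [hs])) hst
    rcases h2 v hv with rfl | h3
    · exact h1.mono fun z hz hzS => hvS (hts z hzS hz ▸ hzS)
    · exact h3.mono fun z hz hzS => hz.2 (hts z hzS hz.1)
  have hQreach : ∀ t ∈ insert y S, ∀ v ∈ Q t, v ∉ S →
      ∃ b ∈ B, (G.deleteEdges {s(x, y)}).JoinedIn (↑S)ᶜ b v := by
    intro t ht v hv hvS
    obtain ⟨a, ha, h1, h2⟩ := hQ t ht
    refine ⟨a, ha, ?_⟩
    have hts : ∀ s ∈ S, s ∈ Q t → s = t := fun s hs hst =>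
      hQd s (by simp [hs]) t ht s (hQmem s (by simp [hs])) hst
    rcases h2 v hv with rfl | h3
    · exact h1.mono fun z hz hzS => hvS (hts z hzS hz ▸ hzS)
    · exact h3.mono fun z hz hzS => hz.2 (hts z hzS hz.1)
  have hcross : ∀ t ∈ insert x S, ∀ t' ∈ insert y S, ∀ v ∈ P t, v ∈ Q t' → t ∈ S ∧ t = t' := by
    intro t ht t' ht' v hv hv'
    have hvS : v ∈ S := by
      by_contra hvS
      obtain ⟨a, ha, h1⟩ := hPreach t ht v hv hvS
      obtain ⟨b, hb, h2⟩ := hQreach t' ht' v hv' hvS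
      exact hS a ha b hb (h1.trans h2.symm)
    have h1 := hPd v (by simp [hvS]) t ht v (hPmem v (by simp [hvS])) hv
    have h2 := hQd v (by simp [hvS]) t' ht' v (hQmem v (by simp [hvS])) hv'
    exact ⟨h1 ▸ hvS, h1.symm.trans h2⟩
  have hle : G.deleteEdges {s(x, y)} ≤ G := deleteEdges_le _
  let σ : V → V := fun t => if t = x then y else t
  have hσ : ∀ t ∈ insert x S, σ t ∈ insert y S := by grind
  have hσinj : ∀ t ∈ insert x S, ∀ t' ∈ insert x S, σ t = σ t' → t = t' := by grind
  have hσS : ∀ t ∈ insert x S, ∀ t' ∈ S, σ t = t' → t = t' := by grind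
  refine ⟨insert x S, hxk, fun t => P t ∪ Q (σ t), fun t ht => ?_, ?_⟩
  · obtain ⟨a, ha, h1, _⟩ := hP t ht
    obtain ⟨b, hb, h2, _⟩ := hQ (σ t) (hσ t ht)
    refine ⟨a, ha, b, hb, ?_⟩
    have h1' := (h1.mono_graph hle).mono (T := P t ∪ Q (σ t)) Set.subset_union_left
    have h2' := (h2.symm.mono_graph hle).mono (T := P t ∪ Q (σ t)) Set.subset_union_right
    by_cases htx : t = x
    · have hσt : σ t = y := if_pos htx
      have hadj : G.Adj t (σ t) := by
        rw [hσt, htx]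
        exact hxy
      exact h1'.trans ((JoinedIn.of_adj hadj h1'.right_mem h2'.left_mem).trans h2')
    · have hσt : σ t = t := if_neg htx
      have h3 : G.JoinedIn (P t ∪ Q (σ t)) a (σ t) := by
        convert h1'
      exact h3.trans h2'
  · rintro t ht t' ht' v (hv | hv) (hv' | hv')
    · exact hPd t ht t' ht' v hv hv'
    · obtain ⟨h1, h2⟩ := hcross t ht _ (hσ t' ht') v hv hv'
      exact (hσS t' ht' t h1 h2.symm).symm
    · obtain ⟨h1, h2⟩ := hcross t' ht' _ (hσ t ht) v hv' hv
      exact hσS t ht t' h1 h2.symm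
    · exact hσinj t ht t' ht' (hQd _ (hσ t ht) _ (hσ t' ht') v hv hv')

/-- The graph obtained from `G` by deleting `u` and identifying vertices with the same image
under `f`. -/
def collapse (G : SimpleGraph V) (f : V → V) (u : V) : SimpleGraph V :=
  SimpleGraph.fromRel fun p q => ∃ p' q', G.Adj p' q' ∧ f p' = p ∧ f q' = q ∧ p' ≠ u ∧ q' ≠ u

lemma JoinedIn.collapse {G : SimpleGraph V} {R : Set V} {p q u : V} (h : G.JoinedIn R p q)
    (hu : u ∉ R) (f : V → V) : (G.collapse f u).JoinedIn (f '' R) (f p) (f q) := by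
  obtain ⟨w, hw⟩ := h
  induction w with
  | nil => exact .refl ⟨_, hw _ (by simp), rfl⟩
  | @cons p c q hadj w ih =>
    have hp : p ∈ R := hw p (by simp)
    have hc : c ∈ R := hw c (by simp)
    refine JoinedIn.trans ?_ (ih fun z hz => hw z (by simp [hz]))
    by_cases hpc : f p = f c
    · rw [hpc]
      exact .refl ⟨c, hc, rfl⟩
    · refine .of_adj ?_ ⟨p, hp, rfl⟩ ⟨c, hc, rfl⟩
      exact (fromRel_adj _ _ _).2 ⟨hpc, Or.inl ⟨p, c, hadj, rfl, rfl, ne_of_mem_of_not_mem hp hu,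
        ne_of_mem_of_not_mem hc hu⟩⟩

/-- A walk in the graph collapsing `X` to `z` lifts to `G`, at least until it reaches `X`. -/
lemma JoinedIn.of_collapse {G : SimpleGraph V} {X C : Set V} {f : V → V} {p q p' u z : V}
    (hz : z ∈ X) (hfX : ∀ v ∈ X, f v = z) (hf : ∀ v ∉ X, f v = v)
    (h : (G.collapse f u).JoinedIn C p q) (hp : f p' = p) (hpu : p' ≠ u) :
    (z ∈ C ∧ ∃ x ∈ X, G.JoinedIn (insert x (C \ (insert u X))) p' x) ∨
      G.JoinedIn (C \ (insert u X)) p' q := by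
  obtain ⟨w, hw⟩ := h
  induction w generalizing p' with
  | @nil p =>
    have hpC : p ∈ C := hw p (by simp)
    by_cases hpX : p' ∈ X
    · refine Or.inl ⟨?_, p', hpX, .refl (Set.mem_insert _ _)⟩
      rwa [← hfX p' hpX, hp]
    · rw [hf p' hpX] at hp
      subst hp
      exact Or.inr (.refl ⟨hpC, by simp [hpX, hpu]⟩)
  | @cons p c q hadj w ih =>
    have hpC : p ∈ C := hw p (by simp)
    by_cases hpX : p' ∈ X
    · refine Or.inl ⟨?_, p', hpX, .refl (Set.mem_insert _ _)⟩
      rwa [← hfX p' hpX, hp]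
    rw [hf p' hpX] at hp
    subst hp
    have hlift : ∀ r, f r = p' → r = p' := by
      intro r hr
      by_cases hrX : r ∈ X
      · rw [hfX r hrX] at hr
        exact absurd (hr ▸ hz) hpX
      · rw [← hr, hf r hrX]
    have hstep : ∃ c', f c' = c ∧ c' ≠ u ∧ G.Adj p' c' := by
      rcases ((fromRel_adj _ _ _).1 hadj).2 with
        ⟨r, s, hrs, hr, hs, _, hsu⟩ | ⟨s, r, hrs, hs, hr, hsu, _⟩
      · exact ⟨s, hs, hsu, hlift r hr ▸ hrs⟩
      · exact ⟨s, hs, hsu, hlift r hr ▸ hrs.symm⟩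
    obtain ⟨c', hc', hcu, hadj'⟩ := hstep
    have hpmem : p' ∈ C \ (insert u X) := ⟨hpC, by simp [hpX, hpu]⟩
    rcases ih hc' hcu fun v hv => hw v (by simp [hv]) with ⟨hzC, x, hx, h⟩ | h
    · exact Or.inl ⟨hzC, x, hx,
        (JoinedIn.of_adj hadj' (Set.mem_insert_of_mem _ hpmem) h.left_mem).trans h⟩
    · exact Or.inr ((JoinedIn.of_adj hadj' hpmem h.left_mem).trans h)

lemma ThreeConnected.joinedIn_compl [Fintype V] {G : SimpleGraph V} (h3 : G.ThreeConnected)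
    {S : Finset V} (hS : S.card ≤ 2) {a b : V} (ha : a ∉ S) (hb : b ∉ S) :
    G.JoinedIn (↑S)ᶜ a b := by
  obtain ⟨w⟩ := (h3.2 (↑S) (by rwa [Set.ncard_coe_finset])).preconnected ⟨a, by simpa using ha⟩
    ⟨b, by simpa using hb⟩
  refine ⟨w.map (Embedding.induce _).toHom, fun z hz => ?_⟩
  obtain ⟨y, _, rfl⟩ := List.mem_map.1 (Walk.support_map (Embedding.induce _).toHom w ▸ hz)
  exact y.2

/-- In a 3-connected graph, two paths from `u` to `a` and `b` avoiding `X` can be replaced by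
three paths from `u` to `a`, `b` and a vertex of `X`, meeting only in `u`. -/
lemma ThreeConnected.exists_fan [Fintype V] {G : SimpleGraph V} (h3 : G.ThreeConnected)
    {u a b : V} {X R₁ R₂ : Set V} (hX : X.Nonempty) (hua : u ≠ a) (hub : u ≠ b)
    (h₁ : G.JoinedIn R₁ u a) (h₂ : G.JoinedIn R₂ u b) (hR : ∀ v ∈ R₁, v ∈ R₂ → v = u)
    (hX₁ : ∀ v ∈ R₁, v ∉ X) (hX₂ : ∀ v ∈ R₂, v ∉ X) :
    ∃ (Q₁ Q₂ Q : Set V) (x : V), x ∈ X ∧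
      G.JoinedIn Q₁ u a ∧ G.JoinedIn Q₂ u b ∧ G.JoinedIn Q u x ∧
      (∀ v ∈ Q₁, v ∉ X) ∧ (∀ v ∈ Q₂, v ∉ X) ∧ (∀ v ∈ Q, v ∈ X → v = x) ∧
      (∀ v ∈ Q₁, v ∈ Q₂ → v = u) ∧ (∀ v ∈ Q₁, v ∈ Q → v = u) ∧ (∀ v ∈ Q₂, v ∈ Q → v = u) := by
  classical
  obtain ⟨z, hz⟩ := hX
  have huX : u ∉ X := hX₁ u h₁.left_mem
  have haX : a ∉ X := hX₁ a h₁.right_mem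
  have hbX : b ∉ X := hX₂ b h₂.right_mem
  have hab : a ≠ b := fun h => hua (hR a h₁.right_mem (h ▸ h₂.right_mem)).symm
  have haz : a ≠ z := fun h => haX (h ▸ hz)
  have hbz : b ≠ z := fun h => hbX (h ▸ hz)
  let f : V → V := fun v => if v ∈ X then z else v
  have hfX : ∀ v ∈ X, f v = z := fun v hv => if_pos hv
  have hf : ∀ v ∉ X, f v = v := fun v hv => if_neg hv
  let N : Set V := {p | ∃ p', G.Adj u p' ∧ f p' = p}
  have hpush : ∀ (R : Set V) (t : V), u ≠ t → G.JoinedIn R u t →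
      ∃ p ∈ N, (G.collapse f u).JoinedIn (f '' (R \ {u})) p (f t) := by
    intro R t hut h
    obtain ⟨p, hp, hpt⟩ := h.exists_adj hut
    exact ⟨f p, ⟨p, hp, rfl⟩, hpt.collapse (fun h => h.2 rfl) f⟩
  let B : Finset V := {a, b, z}
  have hBcard : B.card = 3 := by
    simp [B, hab, haz, hbz]
  have hlink : (G.collapse f u).Linked N B 3 := by
    refine linked_of_forall_separates _ _ _ _ fun S hS => ?_
    by_contra! hcard
    have hhit : ∀ (R : Set V) (t : V), t ∈ B → u ≠ t → t ∉ X → (∀ v ∈ R, v ∉ X) →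
        G.JoinedIn R u t → ∃ s ∈ S, s ∈ R ∧ s ≠ u := by
      intro R t ht hut htX hRX h
      by_contra! hno
      obtain ⟨p, hp, hpt⟩ := hpush R t hut h
      rw [hf t htX] at hpt
      refine hS p hp t ht (hpt.mono ?_)
      rintro _ ⟨v, ⟨hv, hvu⟩, rfl⟩ hvS
      rw [hf v (hRX v hv)] at hvS
      exact hvu (hno v hvS hv)
    obtain ⟨s₁, hs₁, hs₁R, hs₁u⟩ := hhit R₁ a (by simp [B]) hua haX hX₁ h₁
    obtain ⟨s₂, hs₂, hs₂R, hs₂u⟩ := hhit R₂ b (by simp [B]) hub hbX hX₂ h₂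
    have hs : s₁ ≠ s₂ := fun h => hs₁u (hR s₁ hs₁R (h ▸ hs₂R))
    have hthird : ∀ v, v ≠ s₁ → v ≠ s₂ → v ∉ S := by
      intro v h1 h2 hv
      have hsub : ({v, s₁, s₂} : Finset V) ⊆ S := by
        intro w hw
        simp only [Finset.mem_insert, Finset.mem_singleton] at hw
        rcases hw with rfl | rfl | rfl <;> assumption
      have := Finset.card_le_card hsub
      rw [Finset.card_eq_three.2 ⟨v, s₁, s₂, h1, h2, hs, rfl⟩] at this
      omega
    have hzS : z ∉ S := hthird z (fun h => hX₁ _ hs₁R (h ▸ hz)) fun h => hX₂ _ hs₂R (h ▸ hz)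
    have huS : u ∉ S := hthird u hs₁u.symm hs₂u.symm
    obtain ⟨p, hp, hpz⟩ := hpush _ z (fun h => huX (h ▸ hz))
      (h3.joinedIn_compl (by omega) huS hzS)
    rw [hfX z hz] at hpz
    refine hS p hp z (by simp [B]) (hpz.mono ?_)
    rintro _ ⟨v, ⟨hv, _⟩, rfl⟩ hvS
    by_cases hvX : v ∈ X
    · rw [hfX v hvX] at hvS
      exact hzS hvS
    · rw [hf v hvX] at hvS
      exact hv hvS
  obtain ⟨C, hC, hCd⟩ := hlink.exists_label hBcard
  have hmem : ∀ t ∈ B, t ∈ C t := fun t ht => by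
    obtain ⟨_, _, h, _⟩ := hC t ht
    exact h.right_mem
  have haB : a ∈ B := by simp [B]
  have hbB : b ∈ B := by simp [B]
  have hzB : z ∈ B := by simp [B]
  have hpull : ∀ t ∈ B, t ≠ z → G.JoinedIn (insert u (C t \ insert u X)) u t := by
    intro t ht htz
    obtain ⟨_, ⟨p, hp, rfl⟩, h, _⟩ := hC t ht
    rcases h.of_collapse hz hfX hf rfl hp.ne' with ⟨hzC, _⟩ | h
    · exact absurd (hCd t ht z hzB z hzC (hmem z hzB)) htz
    · exact (JoinedIn.of_adj hp (Set.mem_insert _ _) (Set.mem_insert_of_mem _ h.left_mem)).trans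
        (h.mono (Set.subset_insert _ _))
  obtain ⟨x, hx, hxQ⟩ : ∃ x ∈ X, G.JoinedIn (insert u (insert x (C z \ insert u X))) u x := by
    obtain ⟨_, ⟨p, hp, rfl⟩, h, _⟩ := hC z hzB
    rcases h.of_collapse hz hfX hf rfl hp.ne' with ⟨_, x, hx, h⟩ | h
    · exact ⟨x, hx, (JoinedIn.of_adj hp (Set.mem_insert _ _)
        (Set.mem_insert_of_mem _ h.left_mem)).trans (h.mono (Set.subset_insert _ _))⟩
    · exact absurd (Set.mem_insert_of_mem u hz) h.right_mem.2
  refine ⟨_, _, _, x, hx, hpull a haB haz, hpull b hbB hbz, hxQ, ?_, ?_, ?_, ?_, ?_, ?_⟩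
  · rintro v (rfl | hv) hvX
    exacts [huX hvX, hv.2 (Or.inr hvX)]
  · rintro v (rfl | hv) hvX
    exacts [huX hvX, hv.2 (Or.inr hvX)]
  · rintro v (rfl | rfl | hv) hvX
    exacts [absurd hvX huX, rfl, absurd (Or.inr hvX) hv.2]
  · rintro v (hv | hv) (hv' | hv')
    any_goals assumption
    exact absurd (hCd a haB b hbB v hv.1 hv'.1) hab
  · rintro v (hv | hv) (hv' | rfl | hv')
    any_goals assumption
    · exact absurd (Or.inr hx) hv.2
    · exact absurd (hCd a haB z hzB v hv.1 hv'.1) haz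
  · rintro v (hv | hv) (hv' | rfl | hv')
    any_goals assumption
    · exact absurd (Or.inr hx) hv.2
    · exact absurd (hCd b hbB z hzB v hv.1 hv'.1) hbz

end SimpleGraph

namespace SimpleGraph

variable {G : SimpleGraph V}

/-- A path through `x` splits into two parts meeting only in `x`. -/
lemma Walk.IsPath.exists_split {a b x : V} {w : G.Walk a b} (hw : w.IsPath) (hx : x ∈ w.support) :
    ∃ L M : Set V, (∀ v ∈ L, v ∈ w.support) ∧ (∀ v ∈ M, v ∈ w.support) ∧
      G.JoinedIn L a x ∧ G.JoinedIn M x b ∧ ∀ v ∈ L, v ∈ M → v = x := by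
  classical
  refine ⟨{v | v ∈ (w.takeUntil x hx).support}, {v | v ∈ (w.dropUntil x hx).support},
    fun v hv => w.support_takeUntil_subset_support hx hv,
    fun v hv => w.support_dropUntil_subset_support hx hv, ⟨_, fun _ h => h⟩, ⟨_, fun _ h => h⟩, ?_⟩
  intro v hv hv'
  rw [← w.take_spec hx, Walk.isPath_def, Walk.support_append] at hw
  rcases (Walk.mem_support_iff _).1 hv' with h | h
  · exact h
  · exact absurd h (List.disjoint_of_nodup_append hw hv)

lemma injective_update {ι : Type*} [DecidableEq ι] {a : ι → V} (ha : Function.Injective a)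
    {i : ι} {y : V} (hy : ∀ r, y ≠ a r) : Function.Injective (Function.update a i y) := by
  intro r r' hr
  rw [Function.update_apply, Function.update_apply] at hr
  split_ifs at hr with h h'
  exacts [h.trans h'.symm, absurd hr (hy r'), absurd hr.symm (hy r), ha hr]

lemma Hex.exists_of_joinedIn {a b : Fin 3 → V} (injA : Function.Injective a)
    (injB : Function.Injective b) (disjAB : ∀ i j, a i ≠ b j) (S : Fin 3 → Fin 3 → Set V)
    (hS : ∀ i j, G.JoinedIn (S i j) (a i) (b j))
    (hmeet : ∀ i j i' j', (i, j) ≠ (i', j') → ∀ v ∈ S i j, v ∈ S i' j' →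
      (v = a i ∧ i = i') ∨ (v = b j ∧ j = j')) :
    ∃ H : G.Hex, H.fA = a ∧ H.fB = b := by
  choose w hp hw using fun i j => (hS i j).exists_isPath
  exact ⟨⟨a, b, injA, injB, disjAB, w, hp, fun i j i' j' hne x hx hx' =>
    hmeet i j i' j' hne x (hw i j x hx) (hw i' j' x hx')⟩, rfl, rfl⟩

lemma Hex.exists_transpose (H : G.Hex) : ∃ H' : G.Hex, H'.fA = H.fB ∧ H'.fB = H.fA := by
  refine Hex.exists_of_joinedIn H.injB H.injA (fun i j => (H.disjAB j i).symm)
    (fun i j => {v | v ∈ (H.seg j i).support}) (fun i j => JoinedIn.symm ⟨_, fun _ h => h⟩) ?_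
  intro i j i' j' hne v hv hv'
  have := H.seg_meet j i j' i' (by grind) v hv hv'
  tauto

/-- The vertex sets of a hex with feet `a`, `b`, where the segment from `a 0` to `b 0` is
replaced by three paths `R₁`, `R₂`, `Q` from `u` to `a 0`, to `b 0` and to a vertex `x` elsewhere
on the hex. -/
structure HexWithFan (G : SimpleGraph V) (a b : Fin 3 → V) (S : Fin 3 → Fin 3 → Set V)
    (R₁ R₂ Q : Set V) (u x : V) : Prop where
  injA : Function.Injective a
  injB : Function.Injective b
  disjAB : ∀ i j, a i ≠ b j
  joined : ∀ i j, (i, j) ≠ (0, 0) → G.JoinedIn (S i j) (a i) (b j)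
  meet : ∀ i j i' j', (i, j) ≠ (0, 0) → (i', j') ≠ (0, 0) → (i, j) ≠ (i', j') →
    ∀ v ∈ S i j, v ∈ S i' j' → (v = a i ∧ i = i') ∨ (v = b j ∧ j = j')
  split : ∀ i j, (i, j) ≠ (0, 0) → x ∈ S i j → ∃ L M : Set V, L ⊆ S i j ∧ M ⊆ S i j ∧
    G.JoinedIn L (a i) x ∧ G.JoinedIn M x (b j) ∧ ∀ v ∈ L, v ∈ M → v = x
  ne_a : u ≠ a 0
  ne_b : u ≠ b 0
  joined₁ : G.JoinedIn R₁ u (a 0)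
  joined₂ : G.JoinedIn R₂ u (b 0)
  joinedQ : G.JoinedIn Q u x
  meet₁₂ : ∀ v ∈ R₁, v ∈ R₂ → v = u
  meet₁Q : ∀ v ∈ R₁, v ∈ Q → v = u
  meet₂Q : ∀ v ∈ R₂, v ∈ Q → v = u
  meet₁ : ∀ i j, (i, j) ≠ (0, 0) → ∀ v ∈ R₁, v ∈ S i j → v = a 0 ∧ i = 0
  meet₂ : ∀ i j, (i, j) ≠ (0, 0) → ∀ v ∈ R₂, v ∈ S i j → v = b 0 ∧ j = 0
  meetQ : ∀ i j, (i, j) ≠ (0, 0) → ∀ v ∈ Q, v ∈ S i j → v = x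
  x_ne_a : x ≠ a 0
  x_ne_b : x ≠ b 0

namespace HexWithFan

variable {a b : Fin 3 → V} {S : Fin 3 → Fin 3 → Set V} {R₁ R₂ Q : Set V} {u x : V}

lemma transpose (h : G.HexWithFan a b S R₁ R₂ Q u x) :
    G.HexWithFan b a (fun i j => S j i) R₂ R₁ Q u x where
  injA := h.injB
  injB := h.injA
  disjAB i j := (h.disjAB j i).symm
  joined i j hij := (h.joined j i (by grind)).symm
  meet i j i' j' h0 h0' hne v hv hv' :=
    (h.meet j i j' i' (by grind) (by grind) (by grind) v hv hv').symm
  split i j hij hx := by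
    obtain ⟨L, M, hL, hM, hL', hM', hLM⟩ := h.split j i (by grind) hx
    exact ⟨M, L, hM, hL, hM'.symm, hL'.symm, fun v hv hv' => hLM v hv' hv⟩
  ne_a := h.ne_b
  ne_b := h.ne_a
  joined₁ := h.joined₂
  joined₂ := h.joined₁
  joinedQ := h.joinedQ
  meet₁₂ v hv hv' := h.meet₁₂ v hv' hv
  meet₁Q := h.meet₂Q
  meet₂Q := h.meet₁Q
  meet₁ i j hij := h.meet₂ j i (by grind)
  meet₂ i j hij := h.meet₁ j i (by grind)
  meetQ i j hij := h.meetQ j i (by grind)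
  x_ne_a := h.x_ne_b
  x_ne_b := h.x_ne_a

lemma u_notMem (h : G.HexWithFan a b S R₁ R₂ Q u x) {i j : Fin 3} (hij : (i, j) ≠ (0, 0)) :
    u ∉ S i j := fun hu => h.ne_a (h.meet₁ i j hij u h.joined₁.left_mem hu).1

lemma a_mem (h : G.HexWithFan a b S R₁ R₂ Q u x) {i j : Fin 3} (hij : (i, j) ≠ (0, 0)) :
    a i ∈ S i j := (h.joined i j hij).left_mem

lemma b_mem (h : G.HexWithFan a b S R₁ R₂ Q u x) {i j : Fin 3} (hij : (i, j) ≠ (0, 0)) :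
    b j ∈ S i j := (h.joined i j hij).right_mem

lemma u_ne_a (h : G.HexWithFan a b S R₁ R₂ Q u x) (i : Fin 3) : u ≠ a i := fun hu =>
  h.u_notMem (i := i) (j := 1) (by simp) (hu ▸ h.a_mem (by simp))

lemma u_ne_b (h : G.HexWithFan a b S R₁ R₂ Q u x) (j : Fin 3) : u ≠ b j := fun hu =>
  h.u_notMem (i := 1) (j := j) (by simp) (hu ▸ h.b_mem (by simp))

/-- The foot `a 0` can be replaced by `u` when `u` has suitable paths to the other side. -/
lemma exists_hex_of_fan (h : G.HexWithFan a b S R₁ R₂ Q u x) (T : Fin 3 → Set V)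
    (hT : ∀ c, G.JoinedIn (T c) u (b c)) (hTT : ∀ c c', c ≠ c' → ∀ v ∈ T c, v ∈ T c' → v = u)
    (hTS : ∀ c r c', r ≠ 0 → ∀ v ∈ T c, v ∈ S r c' → v = b c ∧ c = c') :
    ∃ H : G.Hex, H.fA = Function.update a 0 u ∧ H.fB = b := by
  have hupd : ∀ r, r ≠ 0 → Function.update a 0 u r = a r := fun r hr => Function.update_of_ne hr _ _
  refine Hex.exists_of_joinedIn (injective_update h.injA h.u_ne_a) h.injB ?_
    (fun r c => if r = 0 then T c else S r c) ?_ ?_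
  · have h1 := h.disjAB
    have h2 := h.u_ne_b
    grind
  · intro r c
    by_cases hr : r = 0
    · subst hr
      simpa using hT c
    · simpa [hr] using h.joined r c (by simp [hr])
  · intro r c r' c' hne v hv hv'
    by_cases hr : r = 0 <;> by_cases hr' : r' = 0
    · subst hr hr'
      simp only [if_true] at hv hv'
      exact Or.inl ⟨by simpa using hTT c c' (by simpa using hne) v hv hv', rfl⟩
    · subst hr
      simp only [if_true, if_neg hr'] at hv hv'
      exact Or.inr (hTS c r' c' hr' v hv hv')
    · subst hr'
      simp only [if_true, if_neg hr] at hv hv'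
      obtain ⟨h1, h2⟩ := hTS c' r c hr v hv' hv
      exact Or.inr ⟨h2 ▸ h1, h2.symm⟩
    · simp only [if_neg hr, if_neg hr'] at hv hv'
      rw [hupd r hr]
      exact h.meet r c r' c' (by simp [hr]) (by simp [hr']) hne v hv hv'

/-- If `x` lies on another segment at `a 0`, then `u` can replace the foot `a 0`. -/
lemma exists_hex_replace_left (h : G.HexWithFan a b S R₁ R₂ Q u x) {j : Fin 3} (hj : j ≠ 0)
    (hx : x ∈ S 0 j) : ∃ H : G.Hex, H.fA = Function.update a 0 u ∧ H.fB = b := by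
  obtain ⟨L, M, hL, hM, hL', hM', hLM⟩ := h.split 0 j (by simpa using hj) hx
  have haM : a 0 ∉ M := fun hm => h.x_ne_a (hLM _ hL'.left_mem hm).symm
  have hxS : ∀ r c, (r, c) ≠ (0, 0) → x ∈ S r c → (r, c) ≠ (0, j) → x = b j ∧ c = j := by
    intro r c hrc hxr hne
    have := h.meet 0 j r c (by simpa using hj) hrc hne.symm x hx hxr
    have := h.x_ne_a
    grind
  let T : Fin 3 → Set V := fun c => if c = 0 then R₂ else if c = j then Q ∪ M else R₁ ∪ S 0 c
  have hT : ∀ c v, v ∈ T c → (c = 0 ∧ v ∈ R₂) ∨ (c = j ∧ v ∈ Q) ∨ (c = j ∧ v ∈ M) ∨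
      (c ≠ 0 ∧ c ≠ j ∧ v ∈ R₁) ∨ (c ≠ 0 ∧ c ≠ j ∧ v ∈ S 0 c) := by
    intro c v hv
    simp only [T] at hv
    grind
  have hTT : ∀ c c', c ≠ c' → ∀ v ∈ T c, v ∈ T c' → v = u := by
    intro c c' hne v hv hv'
    have h1 := h.meet 0 c 0 c'
    have h2 := h.meet₁
    have h3 := h.meet₂
    have h4 := h.meetQ
    have h5 := h.meet₁₂ v
    have h6 := h.meet₁Q v
    have h7 := h.meet₂Q v
    have h8 : v ∈ M → v ∈ S 0 j := fun h => hM h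
    rcases hT c v hv with hv | hv | hv | hv | hv <;>
      rcases hT c' v hv' with hv' | hv' | hv' | hv' | hv'
    all_goals grind
  have hTS : ∀ c r c', r ≠ 0 → ∀ v ∈ T c, v ∈ S r c' → v = b c ∧ c = c' := by
    intro c r c' hr v hv hv'
    have hrc : (r, c') ≠ (0, 0) := by simp [hr]
    have h1 := h.meet 0 c r c'
    have h2 := h.meet₁ r c' hrc v
    have h3 := h.meet₂ r c' hrc v
    have h4 := h.meetQ r c' hrc v
    have h8 : v ∈ M → v ∈ S 0 j := fun h => hM h
    have h9 := h.injA
    rcases hT c v hv with hv | hv | hv | hv | hv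
    all_goals grind [Function.Injective]
  refine h.exists_hex_of_fan T (fun c => ?_) hTT hTS
  by_cases hc : c = 0
  · subst hc
    simpa [T] using h.joined₂
  · by_cases hcj : c = j
    · subst hcj
      simpa [T, hc] using h.joinedQ.trans_union hM'
    · simpa [T, hc, hcj] using h.joined₁.trans_union (h.joined 0 c (by simpa using hc))

set_option maxHeartbeats 1600000 in
/-- If `x` lies on a segment disjoint from the one from `a 0` to `b 0`, then `u` and `x` can
replace one foot on either side. -/
lemma exists_hex_replace_both (h : G.HexWithFan a b S R₁ R₂ Q u x) {i j : Fin 3} (hi : i ≠ 0)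
    (hj : j ≠ 0) (hx : x ∈ S i j) (hxa : x ≠ a i) (hxb : x ≠ b j) :
    ∃ H : G.Hex, H.fA = Function.update a i x ∧ H.fB = Function.update b 0 u := by
  obtain ⟨L, M, hL, hM, hL', hM', hLM⟩ := h.split i j (by simp [hi]) hx
  have haM : a i ∉ M := fun hm => hxa (hLM _ hL'.left_mem hm).symm
  have hbL : b j ∉ L := fun hm => hxb (hLM _ hm hM'.right_mem).symm
  have hxS : ∀ r c, (r, c) ≠ (0, 0) → x ∈ S r c → r = i ∧ c = j := by
    intro r c hrc hxr
    have := h.meet i j r c (by simp [hi]) hrc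
    grind
  have hux : u ≠ x := fun hu => h.u_notMem (by simp [hi]) (hu ▸ hx)
  have hxa' : ∀ r, x ≠ a r := fun r hr => by
    by_cases hri : r = i
    · exact hxa (hri ▸ hr)
    · exact hri (hxS r j (by simp [hj]) (hr ▸ h.a_mem (by simp [hj]))).1
  have hxb' : ∀ c, x ≠ b c := fun c hc => by
    by_cases hcj : c = j
    · exact hxb (hcj ▸ hc)
    · exact hcj (hxS i c (by simp [hi]) (hc ▸ h.b_mem (by simp [hi]))).2
  have hdisj : ∀ r c, Function.update a i x r ≠ Function.update b 0 u c := by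
    intro r c
    rw [Function.update_apply, Function.update_apply]
    split_ifs
    exacts [hux.symm, hxb' c, (h.u_ne_a r).symm, h.disjAB r c]
  have hupd : ∀ r, r ≠ i → Function.update a i x r = a r := fun r hr => Function.update_of_ne hr _ _
  have hupd' : Function.update a i x i = x := Function.update_self _ _ _
  let T : Fin 3 → Set V := fun r => if r = 0 then R₁ else if r = i then Q else R₂ ∪ S r 0
  let U : Fin 3 → Fin 3 → Set V := fun r c =>
    if r = i then (if c = j then M else L ∪ S i c) else S r c
  have hT : ∀ r v, v ∈ T r → (r = 0 ∧ v ∈ R₁) ∨ (r = i ∧ v ∈ Q) ∨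
      (r ≠ 0 ∧ r ≠ i ∧ v ∈ R₂) ∨ (r ≠ 0 ∧ r ≠ i ∧ v ∈ S r 0) := by
    intro r v hv
    simp only [T] at hv
    grind
  have hU : ∀ r c v, v ∈ U r c → (r = i ∧ c = j ∧ v ∈ M) ∨ (r = i ∧ c ≠ j ∧ v ∈ L) ∨
      (r = i ∧ c ≠ j ∧ v ∈ S i c) ∨ (r ≠ i ∧ v ∈ S r c) := by
    intro r c v hv
    simp only [U] at hv
    grind
  have hTT : ∀ r r', r ≠ r' → ∀ v ∈ T r, v ∈ T r' → v = u := by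
    intro r r' hne v hv hv'
    have h2 := h.meet₁
    have h4 := h.meetQ
    have h5 := h.meet₁₂ v
    have h6 := h.meet₁Q v
    have h7 := h.meet₂Q v
    rcases hT r v hv with hv | hv | hv | hv <;> rcases hT r' v hv' with hv' | hv' | hv' | hv'
    all_goals grind
  have hLS : ∀ r c, (r, c) ≠ (0, 0) → ∀ v ∈ L, v ∈ S r c → (r, c) ≠ (i, j) → v = a i ∧ r = i := by
    intro r c hrc v hv hv' hne
    have := h.meet i j r c (by simp [hi]) hrc hne.symm v (hL hv) hv'
    grind
  have hMS : ∀ r c, (r, c) ≠ (0, 0) → ∀ v ∈ M, v ∈ S r c → (r, c) ≠ (i, j) → v = b j ∧ c = j := by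
    intro r c hrc v hv hv' hne
    have := h.meet i j r c (by simp [hi]) hrc hne.symm v (hM hv) hv'
    grind
  have hTU : ∀ r r' c, c ≠ 0 → ∀ v ∈ T r, v ∈ U r' c → v = Function.update a i x r ∧ r = r' := by
    intro r r' c hc v hv hv'
    have h1 := h.meet r 0
    have h2 := h.meet₁
    have h3 := h.meet₂
    have h4 := h.meetQ
    have h8 : v ∈ L → v ∈ S i j := fun h => hL h
    have h9 : v ∈ M → v ∈ S i j := fun h => hM h
    rcases hT r v hv with hv | hv | hv | hv <;> rcases hU r' c v hv' with hv' | hv' | hv' | hv'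
    all_goals grind
  have hUU : ∀ r c r' c', c ≠ 0 → c' ≠ 0 → (r, c) ≠ (r', c') → ∀ v ∈ U r c, v ∈ U r' c' →
      (v = Function.update a i x r ∧ r = r') ∨ (v = b c ∧ c = c') := by
    intro r c r' c' hc hc' hne v hv hv'
    have h1 := h.meet r c r' c' (by simp [hc]) (by simp [hc']) hne v
    have h2 := hLS r c (by simp [hc]) v
    have h2' := hLS r' c' (by simp [hc']) v
    have h3 := hMS r c (by simp [hc]) v
    have h3' := hMS r' c' (by simp [hc']) v
    have h4 := hLM v
    have h5 : c ≠ j → c' ≠ j → c = c' := by omega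
    rcases hU r c v hv with hv | hv | hv | hv <;> rcases hU r' c' v hv' with hv' | hv' | hv' | hv'
    all_goals grind
  refine Hex.exists_of_joinedIn (injective_update h.injA hxa') (injective_update h.injB h.u_ne_b)
    hdisj (fun r c => if c = 0 then T r else U r c) ?_ ?_
  · intro r c
    by_cases hc : c = 0
    · subst hc
      by_cases hr : r = 0
      · subst hr
        simpa [T, hupd 0 hi.symm] using h.joined₁.symm
      · by_cases hri : r = i
        · subst hri
          simpa [T, hr] using h.joinedQ.symm
        · have := (h.joined r 0 (by simp [hr])).trans_union h.joined₂.symm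
          rw [Set.union_comm] at this
          simpa [T, hr, hri] using this
    · by_cases hri : r = i
      · subst hri
        by_cases hcj : c = j
        · subst hcj
          simpa [U, hc] using hM'
        · simpa [U, hc, hcj] using hL'.symm.trans_union (h.joined r c (by simp [hc]))
      · simpa [U, hc, hri] using h.joined r c (by simp [hc])
  · intro r c r' c' hne v hv hv'
    by_cases hc : c = 0 <;> by_cases hc' : c' = 0
    · subst hc hc'
      simp only [if_true] at hv hv'
      exact Or.inr ⟨by simpa using hTT r r' (by simpa using hne) v hv hv', rfl⟩
    · subst hc
      simp only [if_true, if_neg hc'] at hv hv'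
      exact Or.inl (hTU r r' c' hc' v hv hv')
    · subst hc'
      simp only [if_true, if_neg hc] at hv hv'
      obtain ⟨h1, h2⟩ := hTU r' r c hc v hv' hv
      exact Or.inl ⟨h2 ▸ h1, h2.symm⟩
    · simp only [if_neg hc, if_neg hc'] at hv hv'
      rw [Function.update_of_ne hc]
      exact hUU r c r' c' hc hc' hne v hv hv'

end HexWithFan

end SimpleGraph

namespace SimpleGraph

variable {G : SimpleGraph V}

/-- In a 3-connected graph, an interior vertex `u` of the first segment of a hex is the centre of
a fan whose third leg reaches one of the other segments. -/
lemma Hex.exists_hexWithFan [Fintype V] (h3 : G.ThreeConnected) (H : G.Hex) {u : V}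
    (hu : u ∈ (H.seg 0 0).support) (hua : u ≠ H.fA 0) (hub : u ≠ H.fB 0) :
    ∃ R₁ R₂ Q x, (∃ i j, (i, j) ≠ (0, 0) ∧ x ∈ (H.seg i j).support) ∧
      G.HexWithFan H.fA H.fB (fun i j => {v | v ∈ (H.seg i j).support}) R₁ R₂ Q u x := by
  obtain ⟨L, M, hL, hM, hL', hM', hLM⟩ := (H.seg_path 0 0).exists_split hu
  let X : Set V := {v | (∃ i j, (i, j) ≠ (0, 0) ∧ v ∈ (H.seg i j).support) ∧
    v ≠ H.fA 0 ∧ v ≠ H.fB 0}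
  have hX0 : ∀ v ∈ (H.seg 0 0).support, v ∉ X := by
    rintro v hv ⟨⟨i, j, hij, hv'⟩, hva, hvb⟩
    have := H.seg_meet 0 0 i j hij.symm v hv hv'
    tauto
  have hX : X.Nonempty := ⟨H.fA 1, ⟨1, 0, by simp, (H.seg 1 0).start_mem_support⟩,
    H.injA.ne (by decide), H.disjAB 1 0⟩
  obtain ⟨R₁, R₂, Q, x, hx, h₁, h₂, hQ, hX₁, hX₂, hXQ, h12, h1Q, h2Q⟩ :=
    h3.exists_fan hX hua hub hL'.symm hM' hLM (fun v hv => hX0 v (hL v hv))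
      (fun v hv => hX0 v (hM v hv))
  have hXmem : ∀ i j, (i, j) ≠ (0, 0) → ∀ v ∈ (H.seg i j).support,
      v ∈ X ∨ v = H.fA 0 ∨ v = H.fB 0 := by
    intro i j hij v hv
    by_cases ha : v = H.fA 0
    · exact Or.inr (Or.inl ha)
    · by_cases hb : v = H.fB 0
      · exact Or.inr (Or.inr hb)
      · exact Or.inl ⟨⟨i, j, hij, hv⟩, ha, hb⟩
  have hfA : ∀ i j, (i, j) ≠ (0, 0) → H.fA 0 ∈ (H.seg i j).support → i = 0 := by
    intro i j hij hv
    have := H.seg_meet 0 0 i j hij.symm _ (H.seg 0 0).start_mem_support hv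
    have := H.disjAB 0 0
    tauto
  have hfB : ∀ i j, (i, j) ≠ (0, 0) → H.fB 0 ∈ (H.seg i j).support → j = 0 := by
    intro i j hij hv
    have := H.seg_meet 0 0 i j hij.symm _ (H.seg 0 0).end_mem_support hv
    have := (H.disjAB 0 0).symm
    tauto
  refine ⟨R₁, R₂, Q, x, hx.1, ?_⟩
  exact
    { injA := H.injA
      injB := H.injB
      disjAB := H.disjAB
      joined := fun i j _ => ⟨H.seg i j, fun _ h => h⟩
      meet := fun i j i' j' _ _ hne => H.seg_meet i j i' j' hne
      split := fun i j _ hx => (H.seg_path i j).exists_split hx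
      ne_a := hua
      ne_b := hub
      joined₁ := h₁
      joined₂ := h₂
      joinedQ := hQ
      meet₁₂ := h12
      meet₁Q := h1Q
      meet₂Q := h2Q
      meet₁ := by
        intro i j hij v hv hv'
        rcases hXmem i j hij v hv' with h | rfl | rfl
        · exact absurd h (hX₁ v hv)
        · exact ⟨rfl, hfA i j hij hv'⟩
        · exact absurd (h12 _ hv h₂.right_mem).symm hub
      meet₂ := by
        intro i j hij v hv hv'
        rcases hXmem i j hij v hv' with h | rfl | rfl
        · exact absurd h (hX₂ v hv)
        · exact absurd (h12 _ h₁.right_mem hv).symm hua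
        · exact ⟨rfl, hfB i j hij hv'⟩
      meetQ := by
        intro i j hij v hv hv'
        rcases hXmem i j hij v hv' with h | rfl | rfl
        · exact hXQ v hv h
        · exact absurd (h1Q _ h₁.right_mem hv).symm hua
        · exact absurd (h2Q _ h₂.right_mem hv).symm hub
      x_ne_a := hx.2.1
      x_ne_b := hx.2.2 }

lemma IsBipartition.odd_length_iff {A B : Set V} (h : G.IsBipartition A B) {x y : V}
    (w : G.Walk x y) : Odd w.length ↔ ¬(x ∈ A ↔ y ∈ A) := by
  induction w with
  | nil => simp
  | cons hadj w ih =>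
    have hdisj : ∀ v ∈ A, v ∉ B := fun v hv => Set.disjoint_left.1 h.1 hv
    rw [Walk.length_cons, Nat.odd_add_one, ih]
    rcases h.2.2 hadj with ⟨h₁, h₂⟩ | ⟨h₁, h₂⟩
    · have := fun h' => hdisj _ h' h₂
      tauto
    · have := fun h' => hdisj _ h' h₁
      tauto

open Classical in
lemma IsBipartition.oddCount_eq {A B : Set V} (h : G.IsBipartition A B) (H : G.Hex) :
    H.oddCount = ∑ i, ∑ j, if H.fA i ∈ A ↔ H.fB j ∈ A then 0 else 1 := by
  rw [Hex.oddCount, Finset.card_filter, Fintype.sum_prod_type]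
  refine Finset.sum_congr rfl fun i _ => Finset.sum_congr rfl fun j _ => ?_
  simp only [h.odd_length_iff, ite_not]

/-- The three ways of rerouting a hex along a fan at an interior vertex `u` of its first segment:
`u` replaces one of the two ends of the segment, or `u` and a further vertex replace two feet
on different sides. -/
lemma Hex.exists_replace [Fintype V] (h3 : G.ThreeConnected) (H : G.Hex) {u : V}
    (hu : u ∈ (H.seg 0 0).support) (hua : u ≠ H.fA 0) (hub : u ≠ H.fB 0) :
    (∃ H' : G.Hex, H'.fA = Function.update H.fA 0 u ∧ H'.fB = H.fB) ∨
    (∃ H' : G.Hex, H'.fA = H.fA ∧ H'.fB = Function.update H.fB 0 u) ∨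
    ∃ (H' : G.Hex) (i : Fin 3) (x : V), i ≠ 0 ∧ H'.fA = Function.update H.fA i x ∧
      H'.fB = Function.update H.fB 0 u := by
  obtain ⟨R₁, R₂, Q, x, ⟨i, j, hij, hx⟩, h⟩ := H.exists_hexWithFan h3 hu hua hub
  have left : ∀ j, j ≠ 0 → x ∈ (H.seg 0 j).support →
      ∃ H' : G.Hex, H'.fA = Function.update H.fA 0 u ∧ H'.fB = H.fB :=
    fun j hj hx => h.exists_hex_replace_left hj hx
  have right : ∀ i, i ≠ 0 → x ∈ (H.seg i 0).support →
      ∃ H' : G.Hex, H'.fA = H.fA ∧ H'.fB = Function.update H.fB 0 u := by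
    intro i hi hx
    obtain ⟨H₁, hA, hB⟩ := h.transpose.exists_hex_replace_left hi hx
    obtain ⟨H₂, hA', hB'⟩ := H₁.exists_transpose
    exact ⟨H₂, hA'.trans hB, hB'.trans hA⟩
  by_cases hi : i = 0
  · subst hi
    exact Or.inl (left j (by simpa using hij) hx)
  by_cases hj : j = 0
  · subst hj
    exact Or.inr (Or.inl (right i hi hx))
  by_cases hxa : x = H.fA i
  · exact Or.inr (Or.inl (right i hi (hxa ▸ (H.seg i 0).start_mem_support)))
  by_cases hxb : x = H.fB j
  · exact Or.inl (left j hj (hxb ▸ (H.seg 0 j).end_mem_support))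
  obtain ⟨H', hA, hB⟩ := h.exists_hex_replace_both hi hj hx hxa hxb
  exact Or.inr (Or.inr ⟨H', i, x, hi, hA, hB⟩)

end SimpleGraph

/-- If a hex in a 3-connected bipartite graph has (at least) five feet `v₁,…,v₅` in `A`
and `u` is an internal vertex of `P₁₄` lying in `B`, then some hex has strictly more odd
segments; in particular the hex is not optimal. -/
theorem stmt_15 {V : Type u} [Fintype V] (G : SimpleGraph V) (A B : Set V)
    (hbip : G.IsBipartition A B) (h3 : G.ThreeConnected) (H : G.Hex)
    (hA : ∀ i, H.fA i ∈ A) (h4A : H.fB 0 ∈ A) (h5A : H.fB 1 ∈ A)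
    (u : V) (hu : u ∈ (H.seg 0 0).support) (hu1 : u ≠ H.fA 0) (hu2 : u ≠ H.fB 0)
    (huB : u ∈ B) :
    (∃ H' : G.Hex, H.oddCount < H'.oddCount) ∧ ¬ H.Optimal := by
  classical
  suffices hmain : ∃ H' : G.Hex, H.oddCount < H'.oddCount from
    ⟨hmain, fun hopt => hmain.elim fun H' hlt => (hopt H').not_gt hlt⟩
  have huA : u ∉ A := fun h => Set.disjoint_left.1 hbip.1 h huB
  rcases H.exists_replace h3 hu hu1 hu2 with
    ⟨H', ha, hb⟩ | ⟨H', ha, hb⟩ | ⟨H', i, x, hi, ha, hb⟩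
  · refine ⟨H', ?_⟩
    rw [hbip.oddCount_eq, hbip.oddCount_eq, ha, hb]
    by_cases h6 : H.fB 2 ∈ A <;>
      simp [Fin.sum_univ_three, Function.update_apply, hA, h4A, h5A, huA, h6]
  · refine ⟨H', ?_⟩
    rw [hbip.oddCount_eq, hbip.oddCount_eq, ha, hb]
    by_cases h6 : H.fB 2 ∈ A <;>
      simp [Fin.sum_univ_three, Function.update_apply, hA, h4A, h5A, huA, h6]
  · refine ⟨H', ?_⟩
    rw [hbip.oddCount_eq, hbip.oddCount_eq, ha, hb]
    have hi' : i = 1 ∨ i = 2 := by omega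
    by_cases h6 : H.fB 2 ∈ A <;> by_cases hx : x ∈ A <;> rcases hi' with rfl | rfl <;>
      simp [Fin.sum_univ_three, Function.update_apply, hA, h4A, h5A, huA, h6, hx]
end

section
/- There exists a 3-connected bipartite non-planar graph that contains no odd hex. Hence Theorem (every internally 4-connected bipartite non-planar graph has an odd hex) does not extend to all 3-connected bipartite graphs. -/
open SimpleGraph

universe u

variable {V : Type u}

open Complex in
/-- A continuous nowhere-zero function on a simply connected space has a continuous logarithm. -/
theorem exists_continuous_log {X : Type*} [TopologicalSpace X] [SimplyConnectedSpace X]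
    [LocallyPathConnectedSpace X] {F : X → ℂ} (hF : Continuous F) (h0 : ∀ x, F x ≠ 0) :
    ∃ L : X → ℂ, Continuous L ∧ ∀ x, exp (L x) = F x := by
  have x₀ : X := Classical.arbitrary X
  obtain ⟨L, ⟨-, hL⟩, -⟩ := isCoveringMapOn_exp.existsUnique_continuousMap_lifts
    ⟨F, hF⟩ (a₀ := x₀) (exp_log (h0 x₀)) h0
  exact ⟨L, L.continuous, fun x => congrFun hL x⟩

open Complex in
/-- Two continuous logarithms of the same function differ by a constant. -/
theorem continuous_log_sub_eq {L L' : ℝ → ℂ} (hL : Continuous L) (hL' : Continuous L')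
    (h : ∀ s, exp (L s) = exp (L' s)) (s t : ℝ) : L s - L t = L' s - L' t := by
  have hE : exp (L t - L' t) = 1 := by rw [exp_sub, h, div_self (exp_ne_zero _)]
  have huniq := (isCoveringMapOn_exp.existsUnique_continuousMap_lifts
    ⟨fun x => exp (L x), by fun_prop⟩ (a₀ := t) (e₀ := L t) rfl (fun x => exp_ne_zero _)).unique
    (y₁ := ⟨L, hL⟩) (y₂ := ⟨fun x => L' x + (L t - L' t), by fun_prop⟩)
    ⟨rfl, rfl⟩ ⟨by simp, by ext x; simp [exp_add, hE, h]⟩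
  have := DFunLike.congr_fun huniq s
  simp only [ContinuousMap.coe_mk] at this
  rw [this]; ring

/-- The orientation sign of a pair in a linear order. -/
def orderSign {V : Type*} [LT V] [DecidableLT V] (u v : V) : ℤ := if u < v then -1 else 1

open Complex in
open scoped Real in
/-- Integer relations satisfied by every planar embedding: the boundary of each product of two
disjoint edges has total angle zero. The integer `n c a b` measures, up to a fixed choice of
directions between vertices, the angle swept by the edge `ab` as seen from the vertex `c`. -/
theorem PlanarEmbedding.exists_angle_relations {V : Type*} [LinearOrder V] {G : SimpleGraph V}
    (P : PlanarEmbedding G) :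
    ∃ n : V → V → V → ℤ, ∀ a b c d, G.Adj a b → G.Adj c d → a ≠ c → a ≠ d → b ≠ c → b ≠ d →
      2 * (n c a b + n b c d - n a c d - n d a b) +
        (orderSign c b + orderSign a c + orderSign b d + orderSign d a) = 0 := by
  have hπ : (π : ℂ) * I ≠ 0 := by simp [Real.pi_ne_zero]
  let toC : ℝ × ℝ → ℂ := equivRealProdCLM.symm
  have toC_cont : Continuous toC := equivRealProdCLM.symm.continuous
  have toC_inj : Function.Injective toC := equivRealProdCLM.symm.injective
  let γ : ∀ a b, G.Adj a b → ℝ → ℂ := fun a b h s => toC ((P.arc h).extend s)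
  have γ_cont : ∀ a b h, Continuous (γ a b h) := fun a b h =>
    toC_cont.comp (P.arc h).continuous_extend
  have γ_zero : ∀ a b h, γ a b h 0 = toC (P.vmap a) := fun a b h => by simp [γ]
  have γ_one : ∀ a b h, γ a b h 1 = toC (P.vmap b) := fun a b h => by simp [γ]
  have mem_range : ∀ a b (h : G.Adj a b) s, (P.arc h).extend s ∈ Set.range (P.arc h) := by
    intro a b h s
    rw [← Path.extend_range]
    exact ⟨s, rfl⟩
  have γ_ne : ∀ a b h c, c ≠ a → c ≠ b → ∀ s, γ a b h s - toC (P.vmap c) ≠ 0 := by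
    intro a b h c ha hb s hs
    have := toC_inj (sub_eq_zero.mp hs)
    rcases P.arc_vertex h c (this ▸ mem_range a b h s) with h | h
    exacts [ha h, hb h]
  let dir : V → V → ℂ := fun u v =>
    if u < v then log (toC (P.vmap v) - toC (P.vmap u))
    else log (toC (P.vmap u) - toC (P.vmap v)) + π * I
  have vne : ∀ u v, u ≠ v → toC (P.vmap v) - toC (P.vmap u) ≠ 0 := fun u v h h0 =>
    h (P.vmap_inj (toC_inj (sub_eq_zero.mp h0))).symm
  have exp_dir : ∀ u v, u ≠ v → exp (dir u v) = toC (P.vmap v) - toC (P.vmap u) := by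
    intro u v h
    by_cases huv : u < v
    · simp [dir, huv, exp_log (vne u v h)]
    · simp [dir, huv, exp_add, exp_log (vne v u h.symm)]
  have dir_sub : ∀ u v, u ≠ v → dir u v - dir v u = π * I * (orderSign u v : ℤ) := by
    intro u v h
    rcases lt_or_gt_of_ne h with h | h
    · simp [dir, orderSign, h, h.not_gt]
    · simp [dir, orderSign, h, h.not_gt]
  have key : ∀ c a b, ∃ m : ℤ, ∀ h : G.Adj a b, c ≠ a → c ≠ b → ∀ L : ℝ → ℂ, Continuous L →
      (∀ s, exp (L s) = γ a b h s - toC (P.vmap c)) →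
      L 1 - L 0 = dir c b - dir c a + m * (2 * π * I) := by
    intro c a b
    by_cases hc : G.Adj a b ∧ c ≠ a ∧ c ≠ b
    · obtain ⟨h, ha, hb⟩ := hc
      obtain ⟨L₀, hL₀, hexp⟩ := exists_continuous_log
        (F := fun s => γ a b h s - toC (P.vmap c)) ((γ_cont a b h).sub continuous_const)
        (γ_ne a b h c ha hb)
      have : exp (L₀ 1 - L₀ 0) = exp (dir c b - dir c a) := by
        rw [exp_sub, exp_sub, hexp, hexp, exp_dir c b hb, exp_dir c a ha, γ_zero, γ_one]
      obtain ⟨m, hm⟩ := exp_eq_exp_iff_exists_int.mp this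
      exact ⟨m, fun _ _ _ L hL hLe => by
        rw [continuous_log_sub_eq hL hL₀ (fun s => by rw [hLe, hexp]) 1 0, hm]⟩
    · exact ⟨0, fun h ha hb => absurd ⟨h, ha, hb⟩ hc⟩
  choose n hn using key
  refine ⟨n, fun a b c d hab hcd hac had hbc hbd => ?_⟩
  have hne : ∀ x : ℝ × ℝ, γ a b hab x.1 - γ c d hcd x.2 ≠ 0 := by
    intro x hx
    have hx := toC_inj (sub_eq_zero.mp hx)
    have := P.arc_disjoint hab hcd (by simp [hac, had])
      ⟨mem_range a b hab x.1, hx ▸ mem_range c d hcd x.2⟩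
    obtain ⟨h1, h2⟩ := this
    rcases h1 with h1 | h1 <;> rcases h2 with h2 | h2 <;> rw [h1] at h2 <;>
      have := P.vmap_inj h2 <;> contradiction
  obtain ⟨L, hL, hexp⟩ := exists_continuous_log
    (F := fun x : ℝ × ℝ => γ a b hab x.1 - γ c d hcd x.2)
    (((γ_cont a b hab).comp continuous_fst).sub ((γ_cont c d hcd).comp continuous_snd)) hne
  have e1 := hn c a b hab hac.symm hbc.symm (fun s => L (s, 0)) (by fun_prop)
    (fun s => by rw [hexp, γ_zero c d])
  have e2 := hn d a b hab had.symm hbd.symm (fun s => L (s, 1)) (by fun_prop)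
    (fun s => by rw [hexp, γ_one c d])
  have e3 := hn a c d hcd hac had (fun s => L (0, s) + π * I) (by fun_prop)
    (fun s => by rw [exp_add, hexp, exp_pi_mul_I, γ_zero a b]; ring)
  have e4 := hn b c d hcd hbc hbd (fun s => L (1, s) + π * I) (by fun_prop)
    (fun s => by rw [exp_add, hexp, exp_pi_mul_I, γ_one a b]; ring)
  have hsum : (π : ℂ) * I * ((2 * (n c a b + n b c d - n a c d - n d a b) +
      (orderSign c b + orderSign a c + orderSign b d + orderSign d a) : ℤ) : ℂ) = 0 := by
    push_cast
    linear_combination e3 + e2 - e1 - e4 - dir_sub c b hbc.symm - dir_sub a c hac -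
      dir_sub b d hbd - dir_sub d a had.symm
  exact_mod_cast (mul_eq_zero.mp hsum).resolve_left hπ

/-- A mod 2 obstruction to planarity: a symmetric relation `Z` between disjoint oriented edges
`e i` in which every vertex meets an even number of the partners of each edge, and whose total
crossing number with respect to the circular order of the vertices is odd. -/
theorem not_isPlanar_of_obstruction {V ι : Type*} [LinearOrder V] [Fintype V] [LinearOrder ι]
    [Fintype ι] {G : SimpleGraph V} (e : ι → V × V) (Z : ι → ι → Prop) [DecidableRel Z]
    (hadj : ∀ i, G.Adj (e i).1 (e i).2) (hsymm : ∀ i j, Z i j → Z j i)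
    (hdisj : ∀ i j, Z i j → (e i).1 ≠ (e j).1 ∧ (e i).1 ≠ (e j).2 ∧
      (e i).2 ≠ (e j).1 ∧ (e i).2 ≠ (e j).2)
    (heven : ∀ i v, ∑ j, (if Z i j then (if v = (e j).1 then 1 else 0) +
      (if v = (e j).2 then 1 else 0) else 0 : ZMod 2) = 0)
    (hodd : ∑ i, ∑ j, (if i < j ∧ Z i j then
      (((orderSign (e j).1 (e i).2 + orderSign (e i).1 (e j).1 + orderSign (e i).2 (e j).2 +
        orderSign (e j).2 (e i).1) / 2 : ℤ) : ZMod 2) else 0) ≠ 0) :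
    ¬ G.IsPlanar := by
  rintro ⟨P⟩
  obtain ⟨n, hn⟩ := P.exists_angle_relations
  apply hodd
  let N : V → ι → ZMod 2 := fun v i => (n v (e i).1 (e i).2 : ℤ)
  let m : ι → ι → ZMod 2 := fun i j => N (e j).1 i + N (e j).2 i
  have hterm : ∀ i j, Z i j →
      (((orderSign (e j).1 (e i).2 + orderSign (e i).1 (e j).1 + orderSign (e i).2 (e j).2 +
        orderSign (e j).2 (e i).1) / 2 : ℤ) : ZMod 2) = m i j + m j i := by
    intro i j h
    obtain ⟨h1, h2, h3, h4⟩ := hdisj i j h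
    have hrel := hn _ _ _ _ (hadj i) (hadj j) h1 h2 h3 h4
    rw [show (orderSign (e j).1 (e i).2 + orderSign (e i).1 (e j).1 +
      orderSign (e i).2 (e j).2 + orderSign (e j).2 (e i).1) / 2 =
      n (e i).1 (e j).1 (e j).2 + n (e j).2 (e i).1 (e i).2 - n (e j).1 (e i).1 (e i).2 -
        n (e i).2 (e j).1 (e j).2 by omega]
    push_cast
    simp only [m, N, CharTwo.sub_eq_add]
    ring
  have hzero : ∀ i, ∑ j, (if Z i j then m i j else 0) = 0 := by
    intro i
    have hexpand : ∀ w, N w i = ∑ v, (if v = w then 1 else 0) * N v i := by simp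
    calc ∑ j, (if Z i j then m i j else 0)
        = ∑ j, ∑ v, (if Z i j then (if v = (e j).1 then 1 else 0) +
            (if v = (e j).2 then 1 else 0) else 0) * N v i := by
          refine Finset.sum_congr rfl fun j _ => ?_
          split_ifs with h
          · simp only [m, add_mul, Finset.sum_add_distrib, ← hexpand]
          · simp
      _ = 0 := by
          rw [Finset.sum_comm]
          simp only [← Finset.sum_mul, heven, zero_mul, Finset.sum_const_zero]
  calc _ = ∑ i, ∑ j, ((if i < j then if Z i j then m i j else 0 else 0) +
          (if i < j then if Z i j then m j i else 0 else 0)) := by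
        refine Finset.sum_congr rfl fun i _ => Finset.sum_congr rfl fun j _ => ?_
        by_cases h : i < j <;> by_cases h' : Z i j <;> simp [h, h', hterm]
    _ = ∑ i, ∑ j, ((if i < j then if Z i j then m i j else 0 else 0) +
          (if j < i then if Z i j then m i j else 0 else 0)) := by
        simp only [Finset.sum_add_distrib]
        congr 1
        rw [Finset.sum_comm]
        refine Finset.sum_congr rfl fun i _ => Finset.sum_congr rfl fun j _ => ?_
        simp only [show Z j i ↔ Z i j from ⟨hsymm j i, hsymm i j⟩]
    _ = ∑ i, ∑ j, (if Z i j then m i j else 0) := by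
        refine Finset.sum_congr rfl fun i _ => Finset.sum_congr rfl fun j _ => ?_
        rcases lt_trichotomy i j with h | rfl | h
        · simp [h, h.not_gt]
        · have : ¬ Z i i := fun h => (hdisj i i h).1 rfl
          simp [this]
        · simp [h, h.not_gt]
    _ = 0 := by simp [hzero]

/-! ### Three cubes glued along a path

The vertices `0, 1, 2` are shared by the three cubes; each cube is labelled by `0, …, 7`, with two
labels adjacent when their binary expansions differ in one digit. -/

namespace GluedCubes

/-- The cube containing a vertex, with the value `3` for the shared vertices. -/
def page (v : Fin 18) : Fin 4 :=
  if v.val < 3 then 3 else ⟨(v.val - 3) / 5, by omega⟩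

/-- The position of a vertex in its cube. -/
def label (v : Fin 18) : ℕ := if v.val < 3 then v.val else (v.val - 3) % 5 + 3

/-- The vertex of the cube `p` in position `k`. -/
def vertex (p : Fin 3) (k : Fin 8) : Fin 18 :=
  ⟨if k.val < 3 then k.val else 5 * p.val + k.val, by split_ifs <;> omega⟩

/-- Three cubes sharing the path `1, 0, 2`. -/
def graph : SimpleGraph (Fin 18) where
  Adj u v := (label u ^^^ label v = 1 ∨ label u ^^^ label v = 2 ∨ label u ^^^ label v = 4) ∧
    (page u = page v ∨ page u = 3 ∨ page v = 3)
  symm.symm u v h := by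
    rw [Nat.xor_comm (label v), eq_comm (a := page v)]
    tauto
  loopless.irrefl u h := by simp at h

instance : DecidableRel graph.Adj := fun u v => by unfold graph; infer_instance

/-- The vertex `v` lies in the cube `p`. -/
def InPage (p : Fin 3) (v : Fin 18) : Prop := page v = p.castSucc ∨ page v = 3

instance (p : Fin 3) : DecidablePred (InPage p) := fun v => by unfold InPage; infer_instance

/-- The colour of a vertex in the bipartition. -/
def color (v : Fin 18) : Bool :=
  ((label v).testBit 0 ^^ (label v).testBit 1) ^^ (label v).testBit 2

/-- The antipode of a vertex in the cube `p`. -/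
def antipode (p : Fin 3) (v : Fin 18) : Fin 18 := vertex p ⟨7 - label v, by omega⟩

theorem color_ne_of_adj : ∀ {u v : Fin 18}, graph.Adj u v → color u ≠ color v := by
  decide +kernel

theorem isBipartition : graph.IsBipartition {v | color v = true} {v | color v = false} := by
  refine ⟨?_, ?_, fun x y h => ?_⟩
  · rw [Set.disjoint_left]
    simp
  · ext v
    cases h : color v <;> simp [h]
  · have := color_ne_of_adj h
    cases hx : color x <;> cases hy : color y <;> simp_all

/-- The edges of a non-planar subgraph, a hex whose feet are the shared vertices and one vertex in
each cube. -/
def hexEdge (i : Fin 15) : Fin 18 × Fin 18 :=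
  let p : Fin 3 := ⟨i.val / 5, by omega⟩
  ![(vertex p 4, vertex p 0), (vertex p 5, vertex p 1), (vertex p 4, vertex p 5),
    (vertex p 6, vertex p 2), (vertex p 4, vertex p 6)] ⟨i.val % 5, by omega⟩

/-- Two edges of the subgraph given by `hexEdge` lie in segments with no common end. -/
def Independent (i j : Fin 15) : Prop :=
  i.val / 5 ≠ j.val / 5 ∧ (i.val % 5 + 1) / 2 ≠ (j.val % 5 + 1) / 2

instance : DecidableRel Independent := fun i j => by unfold Independent; infer_instance

theorem not_isPlanar : ¬ graph.IsPlanar := by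
  refine not_isPlanar_of_obstruction hexEdge Independent ?_ ?_ ?_ ?_ ?_ <;> decide +kernel

theorem vertex_injective : ∀ p, Function.Injective (vertex p) := by
  unfold Function.Injective
  decide +kernel

theorem exists_vertex_eq : ∀ v, ∃ p k, vertex p k = v := by
  decide +kernel

/-- The positions of a cube outside `S` that lie in `T` or are adjacent to a position in `T`. -/
def grow (S T : Finset (Fin 8)) : Finset (Fin 8) :=
  Finset.univ.filter fun w => w ∉ S ∧ (w ∈ T ∨ ∃ t ∈ T, graph.Adj (vertex 0 t) (vertex 0 w))

theorem mem_iterate_grow : ∀ S : Finset (Fin 8), S.card ≤ 2 → ∀ r ∉ S, ∀ w ∉ S,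
    w ∈ (grow S)^[5] {r} := by
  decide +kernel

theorem vertex_adj_vertex : ∀ p k l, graph.Adj (vertex 0 k) (vertex 0 l) →
    graph.Adj (vertex p k) (vertex p l) := by
  decide +kernel

theorem reachable_of_mem_iterate_grow {S : Set (Fin 18)} {T : Finset (Fin 8)} {p : Fin 3}
    (hST : ∀ k, k ∈ T ↔ vertex p k ∈ S) {r : Fin 8} (hr : vertex p r ∈ Sᶜ) (m : ℕ) :
    ∀ w ∈ (grow T)^[m] {r}, ∃ hw : vertex p w ∈ Sᶜ,
      (graph.induce Sᶜ).Reachable ⟨vertex p r, hr⟩ ⟨vertex p w, hw⟩ := by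
  induction m with
  | zero =>
    intro w hw
    obtain rfl : w = r := by simpa using hw
    exact ⟨hr, .rfl⟩
  | succ m ih =>
    intro w hw
    rw [Function.iterate_succ_apply', grow, Finset.mem_filter] at hw
    obtain ⟨-, hwS, hw | ⟨t, ht, hadj⟩⟩ := hw
    · exact ih w hw
    · obtain ⟨htS, hreach⟩ := ih t ht
      exact ⟨fun h => hwS ((hST w).mpr h), hreach.trans
        (SimpleGraph.Adj.reachable (vertex_adj_vertex p t w hadj))⟩

theorem threeConnected : graph.ThreeConnected := by
  classical
  refine ⟨by simp, fun S hS => ?_⟩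
  obtain ⟨r, hr3, hrS⟩ : ∃ r : Fin 8, r.val < 3 ∧ vertex 0 r ∈ Sᶜ := by
    by_contra! h
    have hsub : (({0, 1, 2} : Finset (Fin 8)).image (vertex 0) : Set (Fin 18)) ⊆ S := by
      intro v hv
      obtain ⟨k, hk, rfl⟩ := Finset.mem_image.mp (Finset.mem_coe.mp hv)
      by_contra hvS
      exact h k (by fin_cases hk <;> simp) hvS
    have hcard := Set.ncard_le_ncard hsub
    rw [Set.ncard_coe_finset, Finset.card_image_of_injective _ (vertex_injective 0)] at hcard
    have : ({0, 1, 2} : Finset (Fin 8)).card = 3 := rfl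
    omega
  have hshared : ∀ p, vertex p r = vertex 0 r := fun p => by simp [vertex, hr3]
  rw [SimpleGraph.connected_iff_exists_forall_reachable]
  refine ⟨⟨vertex 0 r, hrS⟩, fun ⟨v, hv⟩ => ?_⟩
  obtain ⟨p, k, rfl⟩ := exists_vertex_eq v
  let T : Finset (Fin 8) := Finset.univ.filter fun k => vertex p k ∈ S
  have hT : T.card ≤ 2 := by
    rw [← Finset.card_image_of_injective T (vertex_injective p), ← Set.ncard_coe_finset]
    refine (Set.ncard_le_ncard fun v hv => ?_).trans hS
    obtain ⟨k, hk, rfl⟩ := Finset.mem_image.mp (Finset.mem_coe.mp hv)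
    exact (Finset.mem_filter.mp hk).2
  have hST : ∀ k, k ∈ T ↔ vertex p k ∈ S := by simp [T]
  have hr' : vertex p r ∈ Sᶜ := hshared p ▸ hrS
  obtain ⟨_, hreach⟩ := reachable_of_mem_iterate_grow hST hr' 5 k
    (mem_iterate_grow T hT r (fun h => hr' ((hST r).mp h)) k (fun h => hv ((hST k).mp h)))
  simpa only [hshared p] using hreach

end GluedCubes

namespace SimpleGraph.Hex

variable {V : Type*} {G : SimpleGraph V} (H : G.Hex)

theorem fA_mem_seg_iff {i i' j : Fin 3} : H.fA i ∈ (H.seg i' j).support ↔ i = i' := by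
  refine ⟨fun h => ?_, fun h => h ▸ Walk.start_mem_support _⟩
  by_contra hne
  rcases H.seg_meet i j i' j (by simp [hne]) _ (Walk.start_mem_support _) h with h | h
  · exact hne h.2
  · exact H.disjAB i j h.1

theorem fB_mem_seg_iff {i j j' : Fin 3} : H.fB j ∈ (H.seg i j').support ↔ j = j' := by
  refine ⟨fun h => ?_, fun h => h ▸ Walk.end_mem_support _⟩
  by_contra hne
  rcases H.seg_meet i j i j' (by simp [hne]) _ (Walk.end_mem_support _) h with h | h
  · exact H.disjAB i j h.1.symm
  · exact hne h.2

/-- A segment leaving a set of vertices does so along an edge. -/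
theorem exists_boundary_edge {i j : Fin 3} (S : Set V) (hA : H.fA i ∈ S) (hB : H.fB j ∉ S) :
    ∃ u v, u ∈ (H.seg i j).support ∧ v ∈ (H.seg i j).support ∧ G.Adj u v ∧ u ∈ S ∧ v ∉ S := by
  obtain ⟨d, hd, h1, h2⟩ := (H.seg i j).exists_boundary_dart S hA hB
  exact ⟨d.fst, d.snd, Walk.dart_fst_mem_support_of_mem_darts _ hd,
    Walk.dart_snd_mem_support_of_mem_darts _ hd, d.adj, h1, h2⟩

/-- The hex with its two sides exchanged. -/
def swap : G.Hex where
  fA := H.fB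
  fB := H.fA
  injA := H.injB
  injB := H.injA
  disjAB i j := (H.disjAB j i).symm
  seg i j := (H.seg j i).reverse
  seg_path i j := (H.seg_path j i).reverse
  seg_meet i j i' j' hne x h h' := by
    rw [Walk.support_reverse, List.mem_reverse] at h h'
    exact (H.seg_meet j i j' i' (fun h => hne (by simp_all)) x h h').symm

end SimpleGraph.Hex

namespace GluedCubes

theorem page_eq_three_of_adj {u v : Fin 18} (h : graph.Adj u v) (hpage : page u ≠ page v)
    (hu : page u ≠ 3) : page v = 3 := by
  rcases h.2 with h | h | h
  exacts [absurd h hpage, absurd h hu, h]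

theorem page_eq_three_of_adj_of_not_inPage {p : Fin 3} {u v : Fin 18} (h : graph.Adj u v)
    (hu : InPage p u) (hv : ¬ InPage p v) : page u = 3 := by
  by_contra hu3
  refine hv (Or.inr (page_eq_three_of_adj h (fun heq => hv ?_) hu3))
  rwa [InPage, heq] at hu

theorem page_eq_three_iff : ∀ {v : Fin 18}, page v = 3 ↔ v = 0 ∨ v = 1 ∨ v = 2 := by
  decide +kernel

theorem eq_of_inPage_of_adj_zero : ∀ {p : Fin 3} {u : Fin 18}, InPage p u → graph.Adj u 0 →
    u = 1 ∨ u = 2 ∨ u = vertex p 4 := by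
  decide +kernel

theorem eq_of_boundary_edge {p : Fin 3} {u v : Fin 18} (h : graph.Adj u v) (hp : InPage p u)
    (hu : u ≠ 0) (hv : v = 0 ∨ ¬ InPage p v) : u = 1 ∨ u = 2 ∨ u = vertex p 4 := by
  rcases hv with rfl | hv
  · exact eq_of_inPage_of_adj_zero hp h
  · rcases page_eq_three_iff.mp (page_eq_three_of_adj_of_not_inPage h hp hv) with h | h | h
    exacts [absurd h hu, .inl h, .inr (.inl h)]

theorem card_inPage_color (p : Fin 3) :
    (Finset.univ.filter fun v => InPage p v ∧ color v = true).card = 4 := by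
  revert p
  decide +kernel

theorem antipode_spec : ∀ {p : Fin 3} {b : Fin 18}, InPage p b → color b = false →
    InPage p (antipode p b) ∧ color (antipode p b) = true ∧ ¬ graph.Adj (antipode p b) b := by
  decide +kernel

theorem antipode_inj : ∀ {p : Fin 3} {b b' : Fin 18}, InPage p b → InPage p b' →
    antipode p b = antipode p b' → b = b' := by
  decide +kernel

theorem antipode_mem : ∀ {p : Fin 3} {b : Fin 18}, InPage p b → color b = false → b ≠ 0 →
    antipode p b = 1 ∨ antipode p b = 2 ∨ antipode p b = vertex p 4 := by
  decide +kernel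

/-- A cube has only four vertices of each colour. -/
theorem false_of_five {p : Fin 3} {a : Fin 3 → Fin 18} (ha : Function.Injective a) {u u' : Fin 18}
    (hne : u ≠ u') (hu : ∀ i, u ≠ a i) (hu' : ∀ i, u' ≠ a i)
    (hA : ∀ i, InPage p (a i) ∧ color (a i) = true) (hU : InPage p u ∧ color u = true)
    (hU' : InPage p u' ∧ color u' = true) : False := by
  have hsub : insert u (insert u' (Finset.univ.image a)) ⊆
      Finset.univ.filter fun v => InPage p v ∧ color v = true := by
    intro v hv
    simp only [Finset.mem_insert, Finset.mem_image, Finset.mem_univ, true_and] at hv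
    simp only [Finset.mem_filter, Finset.mem_univ, true_and]
    rcases hv with rfl | rfl | ⟨i, rfl⟩
    exacts [hU, hU', hA i]
  have := Finset.card_le_card hsub
  rw [Finset.card_insert_of_notMem (by simp [hne, fun i => (hu i).symm]),
    Finset.card_insert_of_notMem (by simp [fun i => (hu' i).symm]),
    Finset.card_image_of_injective _ ha, card_inPage_color] at this
  simp at this

theorem adj_zero_of_boundary_edge {p : Fin 3} {u v : Fin 18} (h : graph.Adj u v)
    (hp : InPage p u) (hu : u ≠ 0) (hv : v = 0 ∨ ¬ InPage p v) : graph.Adj u 0 := by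
  rcases eq_of_boundary_edge h hp hu hv with rfl | rfl | rfl <;>
    clear h hp hu hv
  · decide
  · decide
  · revert p
    decide +kernel

/-- A segment between two non-adjacent vertices of a cube has an interior vertex in that cube of
the same colour as its first end. -/
theorem exists_mem_seg_of_not_adj (H : graph.Hex) (hB : ∀ j, color (H.fB j) = false) {p : Fin 3}
    {i j : Fin 3} (ha : InPage p (H.fA i)) (hb : InPage p (H.fB j))
    (hn : ¬ graph.Adj (H.fA i) (H.fB j)) :
    ∃ u ∈ (H.seg i j).support, (InPage p u ∧ color u = true) ∧ u ≠ H.fA i := by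
  have hcol : ∀ u, graph.Adj u (H.fB j) → color u = true := fun u hu => by
    simpa [hB] using color_ne_of_adj hu
  suffices ∃ u ∈ (H.seg i j).support, InPage p u ∧ graph.Adj u (H.fB j) by
    obtain ⟨u, hu, hp, hadj⟩ := this
    exact ⟨u, hu, ⟨hp, hcol u hadj⟩, fun h => hn (h ▸ hadj)⟩
  by_cases hz : H.fB j = 0
  · obtain ⟨u, v, hu, -, hadj, ⟨hup, hu0⟩, hv⟩ := H.exists_boundary_edge
      (i := i) (j := j) {u | InPage p u ∧ u ≠ 0} ⟨ha, hz ▸ H.disjAB i j⟩ (by simp [hz])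
    refine ⟨u, hu, hup, hz ▸ adj_zero_of_boundary_edge hadj hup hu0 ?_⟩
    simp only [Set.mem_ofPred_eq] at hv
    tauto
  · obtain ⟨u, v, hu, -, hadj, -, hv⟩ := H.exists_boundary_edge
      (i := i) (j := j) {H.fB j}ᶜ (H.disjAB i j) (by simp)
    obtain rfl : v = H.fB j := by simpa using hv
    refine ⟨u, hu, by_contra fun hup => ?_, hadj⟩
    have hcolor := hB j
    rcases page_eq_three_iff.mp (page_eq_three_of_adj_of_not_inPage hadj.symm hb hup)
      with h | h | h
    · exact hz h
    · rw [h] at hcolor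
      exact absurd hcolor (by decide)
    · rw [h] at hcolor
      exact absurd hcolor (by decide)

/-- If all feet of one side lie in a cube, at most one segment has an interior vertex of their
colour in that cube. -/
theorem false_of_two_spares (H : graph.Hex) (hA : ∀ i, color (H.fA i) = true)
    (hB : ∀ j, color (H.fB j) = false) {p : Fin 3} (hpA : ∀ i, InPage p (H.fA i))
    {i j i' j' : Fin 3} (hne : (i, j) ≠ (i', j')) {u u' : Fin 18}
    (hu : u ∈ (H.seg i j).support) (hu' : u' ∈ (H.seg i' j').support)
    (hU : InPage p u ∧ color u = true) (hU' : InPage p u' ∧ color u' = true)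
    (hui : u ≠ H.fA i) (hui' : u' ≠ H.fA i') : False := by
  refine false_of_five H.injA (u := u) (u' := u') ?_ ?_ ?_ (fun i => ⟨hpA i, hA i⟩) hU hU'
  · rintro rfl
    rcases H.seg_meet i j i' j' hne u hu hu' with h | h
    · exact hui h.1
    · simpa [h.1, hB] using hU.2
  · rintro k rfl
    exact hui (congrArg H.fA (H.fA_mem_seg_iff.mp hu))
  · rintro k rfl
    exact hui' (congrArg H.fA (H.fA_mem_seg_iff.mp hu'))

theorem false_of_all_inPage (H : graph.Hex) (hA : ∀ i, color (H.fA i) = true)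
    (hB : ∀ j, color (H.fB j) = false) {p : Fin 3} (hpA : ∀ i, InPage p (H.fA i))
    (hpB : ∀ j, InPage p (H.fB j)) : False := by
  have hspec := fun j => antipode_spec (hpB j) (hB j)
  have hone : ∀ j j', j ≠ j' → (∃ i, antipode p (H.fB j) = H.fA i) ∨
      ∃ i, antipode p (H.fB j') = H.fA i := by
    intro j j' hne
    by_contra! h
    exact false_of_five H.injA
      (fun heq => hne (H.injB (antipode_inj (hpB j) (hpB j') heq))) h.1 h.2
      (fun i => ⟨hpA i, hA i⟩) ⟨(hspec j).1, (hspec j).2.1⟩ ⟨(hspec j').1, (hspec j').2.1⟩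
  have hspare : ∀ j, (∃ i, antipode p (H.fB j) = H.fA i) →
      ∃ i, ∃ u ∈ (H.seg i j).support, (InPage p u ∧ color u = true) ∧ u ≠ H.fA i := by
    rintro j ⟨i, hi⟩
    exact ⟨i, exists_mem_seg_of_not_adj H hB (hpA i) (hpB j) (hi ▸ (hspec j).2.2)⟩
  obtain ⟨j, j', hne, hj, hj'⟩ : ∃ j j', j ≠ j' ∧ (∃ i, antipode p (H.fB j) = H.fA i) ∧
      ∃ i, antipode p (H.fB j') = H.fA i := by
    rcases hone 0 1 (by decide) with h0 | h1
    · rcases hone 1 2 (by decide) with h1 | h2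
      exacts [⟨0, 1, by decide, h0, h1⟩, ⟨0, 2, by decide, h0, h2⟩]
    · rcases hone 0 2 (by decide) with h0 | h2
      exacts [⟨0, 1, by decide, h0, h1⟩, ⟨1, 2, by decide, h1, h2⟩]
  obtain ⟨i, u, hu, hU, hui⟩ := hspare j hj
  obtain ⟨i', u', hu', hU', hui'⟩ := hspare j' hj'
  exact false_of_two_spares H hA hB hpA (by simp [hne]) hu hu' hU hU' hui hui'

/-- The three segments at a foot outside a cube whose other ends are inside pass through the three
shared vertices. -/
theorem exists_seg_of_shared (H : graph.Hex) {p j₀ : Fin 3} (hpA : ∀ i, InPage p (H.fA i))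
    (hj₀ : ¬ InPage p (H.fB j₀)) {v : Fin 18} (hv : page v = 3) :
    ∃ i, v ∈ (H.seg i j₀).support := by
  have hcross : ∀ i, ∃ u ∈ (H.seg i j₀).support, page u = 3 := by
    intro i
    obtain ⟨u, w, hu, -, hadj, hup, hwp⟩ := H.exists_boundary_edge
      (i := i) (j := j₀) {u | InPage p u} (hpA i) hj₀
    exact ⟨u, hu, page_eq_three_of_adj_of_not_inPage hadj hup hwp⟩
  choose h hmem hpage using hcross
  have hinj : Function.Injective h := by
    intro i i' heq
    by_contra hne
    rcases H.seg_meet i j₀ i' j₀ (by simp [hne]) (h i) (hmem i) (heq ▸ hmem i') with h | h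
    · exact hne h.2
    · exact hj₀ (h.1 ▸ Or.inr (hpage i))
  have himage : Finset.univ.image h = Finset.univ.filter fun v => page v = 3 := by
    refine Finset.eq_of_subset_of_card_le (fun v hv => ?_) ?_
    · obtain ⟨i, -, rfl⟩ := Finset.mem_image.mp hv
      simpa using hpage i
    · rw [Finset.card_image_of_injective _ hinj]
      decide +kernel
  have hmem_v : v ∈ Finset.univ.image h := by simp [himage, hv]
  obtain ⟨i, -, rfl⟩ := Finset.mem_image.mp hmem_v
  exact ⟨i, hmem i⟩

/-- In the situation of `exists_seg_of_shared`, each segment contains just one shared vertex. -/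
theorem eq_of_shared_mem_seg (H : graph.Hex) {p j₀ : Fin 3} (hpA : ∀ i, InPage p (H.fA i))
    (hj₀ : ¬ InPage p (H.fB j₀)) {i : Fin 3} {u v : Fin 18} (hu : page u = 3) (hv : page v = 3)
    (hui : u ∈ (H.seg i j₀).support) (hvi : v ∈ (H.seg i j₀).support) : u = v := by
  choose s hs using fun w : {w : Fin 18 // page w = 3} => exists_seg_of_shared H hpA hj₀ w.2
  have hunique : ∀ (w : {w : Fin 18 // page w = 3}) k, w.1 ∈ (H.seg k j₀).support → k = s w := by
    intro w k hk
    by_contra hne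
    rcases H.seg_meet k j₀ (s w) j₀ (by simp [hne]) w.1 hk (hs w) with h | h
    · exact hne h.2
    · exact hj₀ (h.1 ▸ Or.inr w.2)
  have hsurj : Function.Surjective s := by
    intro k
    obtain ⟨w, x, hw, -, hadj, hwp, hxp⟩ := H.exists_boundary_edge
      (i := k) (j := j₀) {u | InPage p u} (hpA k) hj₀
    have hw3 := page_eq_three_of_adj_of_not_inPage hadj hwp hxp
    exact ⟨⟨w, hw3⟩, (hunique ⟨w, hw3⟩ k hw).symm⟩
  have hinj : Function.Injective s :=
    ((Fintype.bijective_iff_surjective_and_card s).mpr ⟨hsurj, by decide +kernel⟩).1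
  have := hinj ((hunique ⟨u, hu⟩ i hui).symm.trans (hunique ⟨v, hv⟩ i hvi))
  exact congrArg Subtype.val this

theorem vertex_four_mem_seg (H : graph.Hex) {p j₀ : Fin 3} (hpA : ∀ i, InPage p (H.fA i))
    (hj₀ : ¬ InPage p (H.fB j₀)) {i : Fin 3} (hi : (0 : Fin 18) ∈ (H.seg i j₀).support)
    (hne : H.fA i ≠ 0) : vertex p 4 ∈ (H.seg i j₀).support := by
  obtain ⟨u, v, hu, -, hadj, ⟨hup, hu0⟩, hv⟩ := H.exists_boundary_edge
    (i := i) (j := j₀) {u | InPage p u ∧ u ≠ 0} ⟨hpA i, hne⟩ (fun h => hj₀ h.1)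
  simp only [Set.mem_ofPred_eq] at hv
  rcases eq_of_boundary_edge hadj hup hu0 (by tauto) with rfl | rfl | rfl
  · exact absurd (eq_of_shared_mem_seg H hpA hj₀ rfl rfl hu hi) hu0
  · exact absurd (eq_of_shared_mem_seg H hpA hj₀ rfl rfl hu hi) hu0
  · exact hu

theorem false_of_fB_not_inPage (H : graph.Hex) (hA : ∀ i, color (H.fA i) = true)
    (hB : ∀ j, color (H.fB j) = false) {p j₀ : Fin 3} (hpA : ∀ i, InPage p (H.fA i))
    (hj₀ : ¬ InPage p (H.fB j₀)) (hpB : ∀ j, j ≠ j₀ → InPage p (H.fB j)) : False := by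
  have hne0 : ∀ i, H.fA i ≠ 0 := fun i h => by
    have := hA i
    rw [h] at this
    exact absurd this (by decide)
  have hspare : ∀ j, j ≠ j₀ → ∃ i h, page h = 3 ∧ h ∈ (H.seg i j₀).support ∧
      antipode p (H.fB j) = (if h = 0 then vertex p 4 else h) ∧
      ∃ k, ∃ u ∈ (H.seg i k).support, (InPage p u ∧ color u = true) ∧ u ≠ H.fA i := by
    intro j hj
    obtain ⟨hanti, hcol, hnadj⟩ := antipode_spec (hpB j hj) (hB j)
    obtain ⟨i, h, h3, hmem, hv, hvmem⟩ : ∃ i h, page h = 3 ∧ h ∈ (H.seg i j₀).support ∧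
        antipode p (H.fB j) = (if h = 0 then vertex p 4 else h) ∧
        antipode p (H.fB j) ∈ (H.seg i j₀).support := by
      obtain ⟨i, hi⟩ := exists_seg_of_shared H hpA hj₀ (v := 0) rfl
      have hBj : H.fB j ≠ 0 := fun h => hj (H.fB_mem_seg_iff.mp (h ▸ hi))
      rcases antipode_mem (hpB j hj) (hB j) hBj with h | h | h <;> rw [h]
      · obtain ⟨i, hi⟩ := exists_seg_of_shared H hpA hj₀ (v := 1) rfl
        exact ⟨i, 1, rfl, hi, rfl, hi⟩
      · obtain ⟨i, hi⟩ := exists_seg_of_shared H hpA hj₀ (v := 2) rfl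
        exact ⟨i, 2, rfl, hi, rfl, hi⟩
      · exact ⟨i, 0, rfl, hi, rfl, vertex_four_mem_seg H hpA hj₀ hi (hne0 i)⟩
    refine ⟨i, h, h3, hmem, hv, ?_⟩
    by_cases hfoot : antipode p (H.fB j) = H.fA i
    · exact ⟨j, exists_mem_seg_of_not_adj H hB (hpA i) (hpB j hj) (hfoot ▸ hnadj)⟩
    · exact ⟨j₀, _, hvmem, ⟨hanti, hcol⟩, hfoot⟩
  obtain ⟨j, j', hne, hj, hj'⟩ : ∃ j j', j ≠ j' ∧ j ≠ j₀ ∧ j' ≠ j₀ := by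
    clear * -
    revert j₀
    decide
  obtain ⟨i, h, h3, hmem, hv, k, u, hu, hU, hui⟩ := hspare j hj
  obtain ⟨i', h', h3', hmem', hv', k', u', hu', hU', hui'⟩ := hspare j' hj'
  have hii' : i ≠ i' := by
    rintro rfl
    obtain rfl := eq_of_shared_mem_seg H hpA hj₀ h3 h3' hmem hmem'
    exact hne (H.injB (antipode_inj (hpB j hj) (hpB j' hj') (hv.trans hv'.symm)))
  exact false_of_two_spares H hA hB hpA (by simp [hii']) hu hu' hU hU' hui hui'

theorem eq_of_inPage_of_color : ∀ {p : Fin 3} {v : Fin 18}, InPage p v → color v = true →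
    v = 1 ∨ v = 2 ∨ v = vertex p 4 ∨ v = vertex p 7 := by
  decide +kernel

theorem false_of_fA_not_inPage (H : graph.Hex) (hA : ∀ i, color (H.fA i) = true)
    {p i₀ : Fin 3} (hpB : ∀ j, InPage p (H.fB j))
    (hi₀ : ¬ InPage p (H.fA i₀)) (hpA : ∀ i, i ≠ i₀ → InPage p (H.fA i)) : False := by
  have hmem_swap : ∀ {v : Fin 18} {i j}, v ∈ (H.swap.seg j i).support ↔ v ∈ (H.seg i j).support :=
    by simp [SimpleGraph.Hex.swap]
  have hshared : ∀ {v : Fin 18}, page v = 3 → ∃ j, v ∈ (H.seg i₀ j).support := fun hv => by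
    obtain ⟨j, hj⟩ := exists_seg_of_shared H.swap hpB hi₀ hv
    exact ⟨j, hmem_swap.mp hj⟩
  have hfeet : ∀ i, i ≠ i₀ → H.fA i = vertex p 4 ∨ H.fA i = vertex p 7 := by
    intro i hi
    have hnot : page (H.fA i) ≠ 3 := fun h3 => by
      obtain ⟨j, hj⟩ := hshared h3
      exact hi (H.fA_mem_seg_iff.mp hj)
    rcases eq_of_inPage_of_color (hpA i hi) (hA i) with h | h | h
    · exact absurd (h ▸ rfl) hnot
    · exact absurd (h ▸ rfl) hnot
    · exact h
  obtain ⟨i₁, i₂, hne, h₁, h₂, hf₁, hf₂⟩ : ∃ i₁ i₂, i₁ ≠ i₂ ∧ i₁ ≠ i₀ ∧ i₂ ≠ i₀ ∧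
      H.fA i₁ = vertex p 4 ∧ H.fA i₂ = vertex p 7 := by
    obtain ⟨i, i', hne, hi, hi'⟩ : ∃ i i', i ≠ i' ∧ i ≠ i₀ ∧ i' ≠ i₀ := by
      clear * -
      revert i₀
      decide
    rcases hfeet i hi with h | h <;> rcases hfeet i' hi' with h' | h'
    · exact absurd (H.injA (h.trans h'.symm)) hne
    · exact ⟨i, i', hne, hi, hi', h, h'⟩
    · exact ⟨i', i, hne.symm, hi', hi, h', h⟩
    · exact absurd (H.injA (h.trans h'.symm)) hne
  obtain ⟨j, hj⟩ := hshared (v := 0) rfl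
  have hj0 : H.fB j = 0 := by
    by_contra hne0
    have hmem := hmem_swap.mp
      (vertex_four_mem_seg H.swap hpB hi₀ (hmem_swap.mpr hj) hne0)
    exact h₁ (H.fA_mem_seg_iff.mp (hf₁ ▸ hmem))
  obtain ⟨u, v, hu, -, hadj, ⟨hup, hu0⟩, hv⟩ := H.exists_boundary_edge
    (i := i₂) (j := j) {u | InPage p u ∧ u ≠ 0} ⟨hpA i₂ h₂, hj0 ▸ H.disjAB i₂ j⟩ (by simp [hj0])
  simp only [Set.mem_ofPred_eq] at hv
  have hnot : page u ≠ 3 := fun h3 => by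
    obtain ⟨j', hj'⟩ := hshared h3
    rcases H.seg_meet i₂ j i₀ j' (by simp [h₂]) u hu hj' with h | h
    · exact h₂ h.2
    · exact hu0 (h.1.trans hj0)
  rcases eq_of_boundary_edge hadj hup hu0 (by tauto) with rfl | rfl | rfl
  · exact hnot rfl
  · exact hnot rfl
  · exact hne (H.fA_mem_seg_iff.mp (hf₁ ▸ hu))

/-- Distributing the feet of a hex over three pages and a set of shared vertices. -/
theorem feet_distribution : ∀ a b : Fin 3 → Fin 4,
    (Finset.univ.filter fun q : Fin 3 × Fin 3 => a q.1 ≠ b q.2 ∧ a q.1 ≠ 3 ∧ b q.2 ≠ 3).card +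
      (Finset.univ.filter fun i => a i = 3).card + (Finset.univ.filter fun j => b j = 3).card ≤ 3 →
    (∀ i, a i = 3) ∨ (∀ j, b j = 3) ∨ ∃ p : Fin 3,
      ((∀ i, a i = p.castSucc ∨ a i = 3) ∧ ∃ j₀, ∀ j, j ≠ j₀ → b j = p.castSucc ∨ b j = 3) ∨
      ((∀ j, b j = p.castSucc ∨ b j = 3) ∧ ∃ i₀, ∀ i, i ≠ i₀ → a i = p.castSucc ∨ a i = 3) := by
  decide +kernel

/-- Segments between different cubes pass through distinct shared vertices that are not feet. -/
theorem card_cross_add_card_shared_le (H : graph.Hex) :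
    (Finset.univ.filter fun q : Fin 3 × Fin 3 => page (H.fA q.1) ≠ page (H.fB q.2) ∧
        page (H.fA q.1) ≠ 3 ∧ page (H.fB q.2) ≠ 3).card +
      (Finset.univ.filter fun i => page (H.fA i) = 3).card +
      (Finset.univ.filter fun j => page (H.fB j) = 3).card ≤ 3 := by
  set X := Finset.univ.filter fun q : Fin 3 × Fin 3 => page (H.fA q.1) ≠ page (H.fB q.2) ∧
    page (H.fA q.1) ≠ 3 ∧ page (H.fB q.2) ≠ 3 with hX
  have hcross : ∀ q : Fin 3 × Fin 3, ∃ v, q ∈ X →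
      v ∈ (H.seg q.1 q.2).support ∧ page v = 3 ∧ (∀ i, v ≠ H.fA i) ∧ ∀ j, v ≠ H.fB j := by
    intro q
    by_cases hq : q ∈ X
    · obtain ⟨-, hne, h1, h2⟩ := Finset.mem_filter.mp hq
      obtain ⟨u, v, -, hv, hadj, hup, hvp⟩ := H.exists_boundary_edge (i := q.1) (j := q.2)
        {u | page u = page (H.fA q.1)} rfl (fun h => hne h.symm)
      rw [Set.mem_ofPred_eq] at hup hvp
      have hv3 := page_eq_three_of_adj hadj (fun h => hvp (h.symm.trans hup)) (hup ▸ h1)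
      refine ⟨v, fun _ => ⟨hv, hv3, ?_, ?_⟩⟩
      · rintro i rfl
        exact h1 (H.fA_mem_seg_iff.mp hv ▸ hv3)
      · rintro j rfl
        exact h2 (H.fB_mem_seg_iff.mp hv ▸ hv3)
    · exact ⟨0, fun h => absurd h hq⟩
  choose s hs using hcross
  have hinj : Set.InjOn s X := by
    intro q hq q' hq' heq
    by_contra hne
    obtain ⟨hmem, -, hfA, hfB⟩ := hs q hq
    rcases H.seg_meet q.1 q.2 q'.1 q'.2 hne _ hmem (heq ▸ (hs q' hq').1) with h | h
    exacts [hfA _ h.1, hfB _ h.1]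
  set FA := Finset.univ.filter fun i => page (H.fA i) = 3
  set FB := Finset.univ.filter fun j => page (H.fB j) = 3
  have hdisj₁ : Disjoint (X.image s) (FA.image H.fA) := by
    simp only [Finset.disjoint_left, Finset.mem_image, not_exists, not_and]
    rintro _ ⟨q, hq, rfl⟩ i - h
    exact (hs q hq).2.2.1 i h.symm
  have hdisj₂ : Disjoint (X.image s ∪ FA.image H.fA) (FB.image H.fB) := by
    simp only [Finset.disjoint_left, Finset.mem_union, Finset.mem_image, not_exists, not_and]
    rintro _ (⟨q, hq, rfl⟩ | ⟨i, -, rfl⟩) j - h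
    · exact (hs q hq).2.2.2 j h.symm
    · exact H.disjAB i j h.symm
  rw [← Finset.card_image_of_injOn hinj, ← Finset.card_image_of_injective FA H.injA,
    ← Finset.card_image_of_injective FB H.injB, ← Finset.card_union_of_disjoint hdisj₁,
    ← Finset.card_union_of_disjoint hdisj₂]
  have hcard : (Finset.univ.filter fun v => page v = 3).card = 3 := by decide +kernel
  refine (Finset.card_le_card fun v hv => ?_).trans hcard.le
  simp only [Finset.mem_union, Finset.mem_image] at hv
  rw [Finset.mem_filter]
  refine ⟨Finset.mem_univ _, ?_⟩
  rcases hv with (⟨q, hq, rfl⟩ | ⟨i, hi, rfl⟩) | ⟨j, hj, rfl⟩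
  exacts [(hs q hq).2.1, (Finset.mem_filter.mp hi).2, (Finset.mem_filter.mp hj).2]

theorem not_monochromatic_shared (c : Bool) : ¬ ∃ f : Fin 3 → Fin 18, Function.Injective f ∧
    ∀ i, page (f i) = 3 ∧ color (f i) = c := by
  rintro ⟨f, hf, h⟩
  have hsub : Finset.univ.image f ⊆
      Finset.univ.filter fun v => page v = 3 ∧ color v = c := by
    intro v hv
    obtain ⟨i, -, rfl⟩ := Finset.mem_image.mp hv
    simpa using h i
  have hcard := Finset.card_le_card hsub
  rw [Finset.card_image_of_injective _ hf, Finset.card_fin] at hcard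
  clear * - hcard
  revert c
  decide +kernel

theorem false_of_colored_hex (H : graph.Hex) (hA : ∀ i, color (H.fA i) = true)
    (hB : ∀ j, color (H.fB j) = false) : False := by
  rcases feet_distribution (fun i => page (H.fA i)) (fun j => page (H.fB j))
      (card_cross_add_card_shared_le H) with
    h | h | ⟨p, ⟨hpA, j₀, hpB⟩ | ⟨hpB, i₀, hpA⟩⟩
  · exact not_monochromatic_shared true ⟨H.fA, H.injA, fun i => ⟨h i, hA i⟩⟩
  · exact not_monochromatic_shared false ⟨H.fB, H.injB, fun j => ⟨h j, hB j⟩⟩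
  · by_cases hj₀ : InPage p (H.fB j₀)
    · refine false_of_all_inPage H hA hB (p := p) hpA fun j => ?_
      by_cases hj : j = j₀
      exacts [hj ▸ hj₀, hpB j hj]
    · exact false_of_fB_not_inPage H hA hB hpA hj₀ hpB
  · by_cases hi₀ : InPage p (H.fA i₀)
    · refine false_of_all_inPage H hA hB (p := p) (fun i => ?_) hpB
      by_cases hi : i = i₀
      exacts [hi ▸ hi₀, hpA i hi]
    · exact false_of_fA_not_inPage H hA hpB hi₀ hpA

theorem not_exists_odd_hex : ¬ ∃ H : graph.Hex, H.IsOdd := by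
  rintro ⟨H, hodd⟩
  let c : graph.Coloring Bool := SimpleGraph.Coloring.mk color color_ne_of_adj
  have hcol : ∀ i j, color (H.fB j) = !color (H.fA i) := by
    intro i j
    have : ¬ color (H.fA i) = true ↔ color (H.fB j) = true :=
      (c.odd_length_iff_not_congr (H.seg i j)).mp (hodd i j)
    cases hi : color (H.fA i) <;> cases hj : color (H.fB j) <;> simp_all
  cases h0 : color (H.fA 0)
  · have hB : ∀ j, color (H.fB j) = true := fun j => by simp [hcol 0 j, h0]
    have hA : ∀ i, color (H.fA i) = false := fun i => by simpa [hB] using hcol i 0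
    exact false_of_colored_hex H.swap hB hA
  · have hB : ∀ j, color (H.fB j) = false := fun j => by simp [hcol 0 j, h0]
    exact false_of_colored_hex H (fun i => by simpa [hB] using hcol i 0) hB

end GluedCubes

/-- There is a 3-connected bipartite non-planar graph with no odd hex. -/
theorem stmt_18 :
    ∃ (V : Type) (inst : Fintype V) (G : SimpleGraph V) (A B : Set V),
      G.IsBipartition A B ∧ @SimpleGraph.ThreeConnected V inst G ∧ ¬ G.IsPlanar ∧
        ¬ ∃ H : G.Hex, H.IsOdd := by
  exact ⟨Fin 18, inferInstance, GluedCubes.graph, _, _, GluedCubes.isBipartition,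
    GluedCubes.threeConnected, GluedCubes.not_isPlanar, GluedCubes.not_exists_odd_hex⟩
end
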